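/- If G is a smallest counterexample, then every vertex of G of degree four that is not contained in any 5-cycle has weight at most 6. -/

import Mathlib

open SimpleGraph

/-- The degree of a vertex, as the cardinality of its neighbor set. -/
noncomputable def deg {V : Type} (G : SimpleGraph V) (v : V) : ℕ :=
  (G.neighborSet v).ncard

/-- The potential of a finite graph: `5 n(G) - 4 e(G)`. -/
noncomputable def pot {V : Type} [Fintype V] (G : SimpleGraph V) : ℤ :=
  5 * (Fintype.card V : ℤ) - 4 * (G.edgeSet.ncard : ℤ)

/-- A graph is 5/2-critical if it has no homomorphism to the 5-cycle
but every proper subgraph has one. -/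
def Critical52 {V : Type} (G : SimpleGraph V) : Prop :=
  IsEmpty (G →g cycleGraph 5) ∧
  ∀ H : G.Subgraph, H ≠ ⊤ → Nonempty (H.coe →g cycleGraph 5)

/-- The exceptional graph `E₁`: a 9-cycle `0 1 2 3 4 5 6 7 8` together
with a vertex `9` adjacent to `0`, `3` and `6`. -/
def E1 : SimpleGraph (Fin 10) := SimpleGraph.fromEdgeSet
  {s(0,1), s(1,2), s(2,3), s(3,4), s(4,5), s(5,6), s(6,7), s(7,8), s(8,0),
   s(9,0), s(9,3), s(9,6)}

/-- The exceptional graph `E₂`: two 5-cycles `0 1 2 3 4` and `0 1 5 6 7`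
sharing exactly the edge `01`, together with a path `3 8 9 6`. -/
def E2 : SimpleGraph (Fin 10) := SimpleGraph.fromEdgeSet
  {s(0,1), s(1,2), s(2,3), s(3,4), s(4,0),
   s(1,5), s(5,6), s(6,7), s(7,0),
   s(3,8), s(8,9), s(9,6)}

/-- A smallest counterexample: a 5/2-critical graph, not isomorphic to `C₃`, `E₁`, `E₂`,
with potential at least 2, such that every smaller 5/2-critical graph not isomorphic
to `C₃`, `E₁`, `E₂` has potential at most 1. -/
def SmallestCex {V : Type} [Fintype V] (G : SimpleGraph V) : Prop :=
  Critical52 G ∧ IsEmpty (G ≃g cycleGraph 3) ∧ IsEmpty (G ≃g E1) ∧ IsEmpty (G ≃g E2) ∧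
  2 ≤ pot G ∧
  ∀ (m : ℕ) (H : SimpleGraph (Fin m)), Critical52 H →
    IsEmpty (H ≃g cycleGraph 3) → IsEmpty (H ≃g E1) → IsEmpty (H ≃g E2) →
    m < Fintype.card V → pot H ≤ 1

/-- A string: a path of positive length whose endvertices have degree at least 3
and whose internal vertices have degree 2. A `k`-string is a string of length `k+1`. -/
def IsString {V : Type} (G : SimpleGraph V) {u v : V} (p : G.Walk u v) : Prop :=
  p.IsPath ∧ 0 < p.length ∧ 3 ≤ deg G u ∧ 3 ≤ deg G v ∧
  ∀ w ∈ p.support, w ≠ u → w ≠ v → deg G w = 2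

/-- `v` lies on a 5-cycle of `G`. -/
def InFiveCycle {V : Type} (G : SimpleGraph V) (v : V) : Prop :=
  ∃ (w : V) (c : G.Walk w w), c.IsCycle ∧ c.length = 5 ∧ v ∈ c.support

/-- `v` is a `(k₁,k₂,k₃)`-vertex: it has degree 3 and is the end of a `k₁`-string,
a `k₂`-string and a `k₃`-string leaving `v` through its three distinct edges. -/
def IsVertex3 {V : Type} (G : SimpleGraph V) (v : V) (k1 k2 k3 : ℕ) : Prop :=
  deg G v = 3 ∧ ∃ (u1 u2 u3 : V) (p1 : G.Walk v u1) (p2 : G.Walk v u2) (p3 : G.Walk v u3),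
    IsString G p1 ∧ IsString G p2 ∧ IsString G p3 ∧
    p1.getVert 1 ≠ p2.getVert 1 ∧ p1.getVert 1 ≠ p3.getVert 1 ∧ p2.getVert 1 ≠ p3.getVert 1 ∧
    p1.length = k1 + 1 ∧ p2.length = k2 + 1 ∧ p3.length = k3 + 1

/-- `v` is a `(k₁,k₂,k₃,k₄)`-vertex: it has degree 4 and is the end of strings of the
corresponding lengths leaving `v` through its four distinct edges. -/
def IsVertex4 {V : Type} (G : SimpleGraph V) (v : V) (k1 k2 k3 k4 : ℕ) : Prop :=
  deg G v = 4 ∧ ∃ (u1 u2 u3 u4 : V) (p1 : G.Walk v u1) (p2 : G.Walk v u2)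
    (p3 : G.Walk v u3) (p4 : G.Walk v u4),
    IsString G p1 ∧ IsString G p2 ∧ IsString G p3 ∧ IsString G p4 ∧
    p1.getVert 1 ≠ p2.getVert 1 ∧ p1.getVert 1 ≠ p3.getVert 1 ∧ p1.getVert 1 ≠ p4.getVert 1 ∧
    p2.getVert 1 ≠ p3.getVert 1 ∧ p2.getVert 1 ≠ p4.getVert 1 ∧ p3.getVert 1 ≠ p4.getVert 1 ∧
    p1.length = k1 + 1 ∧ p2.length = k2 + 1 ∧ p3.length = k3 + 1 ∧ p4.length = k4 + 1

/-- `H` contains at least two distinct cycles, where cycles are counted as subgraphs,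
i.e. two cycles are distinct if their edge sets differ. -/
def TwoDistinctCycles {V : Type} (H : SimpleGraph V) : Prop :=
  ∃ (v1 v2 : V) (c1 : H.Walk v1 v1) (c2 : H.Walk v2 v2),
    c1.IsCycle ∧ c2.IsCycle ∧ {e | e ∈ c1.edges} ≠ {e | e ∈ c2.edges}

/-- The degree of a 5-cycle (cell) `c` in `G`: the number of strings not contained in `c`
that intersect `c`, strings being counted by their edge sets. -/
noncomputable def cellDegree {V : Type} (G : SimpleGraph V) {w : V} (c : G.Walk w w) : ℕ :=
  {S : Set (Sym2 V) | ∃ (u v : V) (p : G.Walk u v), IsString G p ∧ S = {e | e ∈ p.edges} ∧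
    ¬ S ⊆ {e | e ∈ c.edges} ∧ ∃ x ∈ p.support, x ∈ c.support}.ncard



/-- Adjacency of colours on the 5-cycle. -/
def CA (x y : Fin 5) : Prop := x - y = 1 ∨ y - x = 1

instance : DecidableRel CA := fun x y => by unfold CA; infer_instance

lemma CA_iff (x y : Fin 5) : (cycleGraph 5).Adj x y ↔ CA x y := by
  rw [CA]; exact cycleGraph_adj

lemma CA_symm {x y : Fin 5} (h : CA x y) : CA y x := Or.symm h

lemma CA_ne {x y : Fin 5} (h : CA x y) : x ≠ y := by
  revert x y; decide

/-- `g` is a colouring of `K` by the 5-cycle. -/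
def Col {V : Type} (K : SimpleGraph V) (g : V → Fin 5) : Prop :=
  ∀ x y, K.Adj x y → CA (g x) (g y)

lemma Col.mono {V : Type} {K K' : SimpleGraph V} {g : V → Fin 5} (h : Col K g) (hle : K' ≤ K) :
    Col K' g := fun x y hxy => h x y (hle hxy)

lemma not_col_of_isEmpty {V : Type} {G : SimpleGraph V} (h : IsEmpty (G →g cycleGraph 5))
    (g : V → Fin 5) : ¬ Col G g := fun hg =>
  h.false ⟨g, fun {a b} hab => (CA_iff _ _).2 (hg a b hab)⟩

lemma crit_min {V : Type} {G : SimpleGraph V} (h : Critical52 G) {K : SimpleGraph V}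
    (hle : K ≤ G) (hne : K ≠ G) : ∃ g, Col K g := by
  let H : G.Subgraph := G.toSubgraph K hle
  have hH : H ≠ ⊤ := by
    intro hh
    apply hne
    ext x y
    have : H.Adj x y ↔ (⊤ : G.Subgraph).Adj x y := by rw [hh]
    simpa [H] using this
  obtain ⟨φ⟩ := h.2 H hH
  refine ⟨fun x => φ ⟨x, trivial⟩, fun x y hxy => ?_⟩
  rw [← CA_iff]
  apply φ.map_adj
  exact hxy

lemma crit_nbr {V : Type} {G : SimpleGraph V} (h : Critical52 G) (w : V) : ∃ y, G.Adj w y := by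
  classical
  by_contra hc
  push Not at hc
  let H : G.Subgraph := (⊤ : G.Subgraph).deleteVerts {w}
  have hH : H ≠ ⊤ := by
    intro hh
    have : w ∈ H.verts := by rw [hh]; trivial
    simp [H] at this
  obtain ⟨φ⟩ := h.2 H hH
  refine not_col_of_isEmpty h.1 (fun x => if hx : x = w then 0 else φ ⟨x, by simp [H, hx]⟩) ?_
  intro x y hxy
  have hx : x ≠ w := by rintro rfl; exact hc _ hxy
  have hy : y ≠ w := by rintro rfl; exact hc _ hxy.symm
  simp only [hx, hy, dite_false]
  rw [← CA_iff]
  apply φ.map_adj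
  simp [H, hx, hy, hxy]

section counting
open Classical

variable {V : Type}

/-- Number of ordered adjacent pairs inside `A`. -/
noncomputable def DD (K : SimpleGraph V) (A : Finset V) : ℕ :=
  ((A ×ˢ A).filter (fun p => K.Adj p.1 p.2)).card

/-- Potential of the subgraph induced by `A`. -/
noncomputable def pp (K : SimpleGraph V) (A : Finset V) : ℤ :=
  5 * (A.card : ℤ) - 2 * (DD K A : ℤ)

lemma DD_mono_graph {K K' : SimpleGraph V} (h : K ≤ K') (A : Finset V) : DD K A ≤ DD K' A := by
  apply Finset.card_le_card
  intro p hp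
  simp only [Finset.mem_filter] at hp ⊢
  exact ⟨hp.1, h hp.2⟩

lemma DD_congr {K K' : SimpleGraph V} {A : Finset V}
    (h : ∀ x ∈ A, ∀ y ∈ A, K.Adj x y ↔ K'.Adj x y) : DD K A = DD K' A := by
  unfold DD
  congr 1
  apply Finset.filter_congr
  intro p hp
  rw [Finset.mem_product] at hp
  exact h _ hp.1 _ hp.2

/-- Neighbours of `y` inside `A`. -/
noncomputable def nb (K : SimpleGraph V) (y : V) (A : Finset V) : Finset V :=
  A.filter (fun x => K.Adj y x)

lemma DD_insert (K : SimpleGraph V) (A : Finset V) (y : V) (hy : y ∉ A) :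
    DD K (insert y A) = DD K A + 2 * (nb K y A).card := by
  have : ((insert y A ×ˢ insert y A).filter (fun p => K.Adj p.1 p.2)) =
      ((A ×ˢ A).filter (fun p => K.Adj p.1 p.2)) ∪
      (((nb K y A).image (fun x => (y, x))) ∪ ((nb K y A).image (fun x => (x, y)))) := by
    ext ⟨a, b⟩
    simp only [nb, Finset.mem_filter, Finset.mem_product, Finset.mem_insert, Finset.mem_union,
      Finset.mem_image, Prod.mk.injEq]
    constructor
    · rintro ⟨⟨rfl | ha, rfl | hb⟩, hab⟩
      · exact absurd hab (K.irrefl)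
      · exact Or.inr (Or.inl ⟨b, ⟨hb, hab⟩, rfl, rfl⟩)
      · exact Or.inr (Or.inr ⟨a, ⟨ha, hab.symm⟩, rfl, rfl⟩)
      · exact Or.inl ⟨⟨ha, hb⟩, hab⟩
    · rintro (⟨⟨ha, hb⟩, hab⟩ | ⟨x, ⟨hx, hyx⟩, rfl, rfl⟩ | ⟨x, ⟨hx, hyx⟩, rfl, rfl⟩)
      · exact ⟨⟨Or.inr ha, Or.inr hb⟩, hab⟩
      · exact ⟨⟨Or.inl rfl, Or.inr hx⟩, hyx⟩
      · exact ⟨⟨Or.inr hx, Or.inl rfl⟩, hyx.symm⟩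
  unfold DD
  rw [this, Finset.card_union_of_disjoint, Finset.card_union_of_disjoint,
    Finset.card_image_of_injective, Finset.card_image_of_injective]
  · ring
  · intro a b; simp
  · intro a b; simp
  · rw [Finset.disjoint_left]
    simp only [nb, Finset.mem_image, Finset.mem_filter]
    rintro _ ⟨x, ⟨hx, _⟩, rfl⟩ ⟨z, ⟨hz, _⟩, h⟩
    simp only [Prod.mk.injEq] at h
    exact hy (h.1 ▸ hz)
  · rw [Finset.disjoint_left]
    simp only [nb, Finset.mem_image, Finset.mem_filter, Finset.mem_product, Finset.mem_union]
    rintro p ⟨⟨h1, h2⟩, _⟩ (⟨x, _, rfl⟩ | ⟨x, _, rfl⟩)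
    · exact hy h1
    · exact hy h2

lemma pp_insert (K : SimpleGraph V) (A : Finset V) (y : V) (hy : y ∉ A) :
    pp K (insert y A) = pp K A + 5 - 4 * ((nb K y A).card : ℤ) := by
  unfold pp
  rw [DD_insert K A y hy, Finset.card_insert_of_notMem hy]
  push_cast
  ring

lemma pp_insert_le (K : SimpleGraph V) (A : Finset V) (y x : V) (hy : y ∉ A) (hx : x ∈ A)
    (hxy : K.Adj y x) : pp K (insert y A) ≤ pp K A + 1 := by
  rw [pp_insert K A y hy]
  have : 1 ≤ (nb K y A).card := Finset.card_pos.2 ⟨x, by simp [nb, hx, hxy]⟩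
  have : (1 : ℤ) ≤ (nb K y A).card := by exact_mod_cast this
  linarith

lemma pp_insert_le2 (K : SimpleGraph V) (A : Finset V) (y x x' : V) (hy : y ∉ A) (hx : x ∈ A)
    (hxy : K.Adj y x) (hx' : x' ∈ A) (hxy' : K.Adj y x') (hne : x ≠ x') :
    pp K (insert y A) ≤ pp K A - 3 := by
  rw [pp_insert K A y hy]
  have : 2 ≤ (nb K y A).card := by
    rw [← Finset.card_pair hne]
    apply Finset.card_le_card
    intro z; simp only [nb, Finset.mem_insert, Finset.mem_singleton, Finset.mem_filter]
    rintro (rfl | rfl) <;> simp [*]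
  have : (2 : ℤ) ≤ (nb K y A).card := by exact_mod_cast this
  linarith

lemma pp_insert_le3 (K : SimpleGraph V) (A : Finset V) (y x x' x'' : V) (hy : y ∉ A) (hx : x ∈ A)
    (hxy : K.Adj y x) (hx' : x' ∈ A) (hxy' : K.Adj y x') (hx'' : x'' ∈ A) (hxy'' : K.Adj y x'')
    (hne : x ≠ x') (hne' : x ≠ x'') (hne'' : x' ≠ x'') :
    pp K (insert y A) ≤ pp K A - 7 := by
  rw [pp_insert K A y hy]
  have : 3 ≤ (nb K y A).card := by
    rw [← Finset.card_eq_three.2 ⟨x, x', x'', hne, hne', hne'', rfl⟩]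
    apply Finset.card_le_card
    intro z; simp only [nb, Finset.mem_insert, Finset.mem_singleton, Finset.mem_filter]
    rintro (rfl | rfl | rfl) <;> simp [*]
  have : (3 : ℤ) ≤ (nb K y A).card := by exact_mod_cast this
  linarith

lemma pp_singleton (K : SimpleGraph V) (y : V) : pp K {y} = 5 := by
  have h := pp_insert K ∅ y (by simp)
  simp [nb, pp, DD] at h ⊢

lemma DD_univ [Fintype V] (G : SimpleGraph V) : DD G Finset.univ = 2 * G.edgeSet.ncard := by
  have h1 := G.dart_card_eq_twice_card_edges
  rw [← SimpleGraph.coe_edgeFinset, Set.ncard_coe_finset, ← h1]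
  unfold DD
  rw [← Fintype.card_coe]
  refine Fintype.card_congr ⟨fun p => ⟨p.1, by simpa using p.2⟩, fun d => ⟨d.toProd, by simpa using d.adj⟩,
    fun _ => rfl, fun _ => rfl⟩

lemma pot_eq [Fintype V] (G : SimpleGraph V) : pot G = pp G Finset.univ := by
  unfold pot pp
  rw [DD_univ, Finset.card_univ]
  push_cast
  ring

end counting


section base
open Classical

/-- `F` is the graph `M` restricted to its support, via the labelling `i`. -/
def IsLab {V : Type} {k : ℕ} (M : SimpleGraph V) (F : SimpleGraph (Fin k)) (i : Fin k → V) : Prop :=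
  Function.Injective i ∧ (∀ x, (∃ y, M.Adj x y) ↔ ∃ a, i a = x) ∧
    ∀ a b, M.Adj (i a) (i b) ↔ F.Adj a b

lemma IsLab.iso {V : Type} {k m : ℕ} {M : SimpleGraph V} {F : SimpleGraph (Fin k)}
    {F' : SimpleGraph (Fin m)} {i : Fin k → V} (h : IsLab M F i) (e : F ≃g F') :
    IsLab M F' (i ∘ e.symm) := by
  refine ⟨h.1.comp e.symm.injective, fun x => ?_, fun a b => ?_⟩
  · rw [h.2.1 x]
    constructor
    · rintro ⟨a, rfl⟩; exact ⟨e a, by simp⟩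
    · rintro ⟨a, rfl⟩; exact ⟨e.symm a, rfl⟩
  · rw [Function.comp, Function.comp, h.2.2]
    exact e.symm.map_adj_iff

lemma IsLab.DD {V : Type} [Fintype V] {k : ℕ} {M : SimpleGraph V} {F : SimpleGraph (Fin k)}
    {i : Fin k → V} (h : IsLab M F i) : DD M Finset.univ = DD F Finset.univ := by
  unfold _root_.DD
  symm
  apply Finset.card_bij (fun p _ => (i p.1, i p.2))
  · rintro ⟨a, b⟩ hp
    simpa [h.2.2] using hp
  · rintro ⟨a, b⟩ _ ⟨c, d⟩ _ hh
    simp only [Prod.mk.injEq] at hh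
    rw [h.1 hh.1, h.1 hh.2]
  · rintro ⟨x, y⟩ hp
    simp only [Finset.mem_filter] at hp
    obtain ⟨a, rfl⟩ := (h.2.1 x).1 ⟨y, hp.2⟩
    obtain ⟨b, rfl⟩ := (h.2.1 y).1 ⟨_, hp.2.symm⟩
    exact ⟨(a, b), by simpa [h.2.2] using hp.2, rfl⟩

/-- The support of a graph as a finset. -/
noncomputable def supp {V : Type} [Fintype V] (M : SimpleGraph V) : Finset V :=
  Finset.univ.filter (fun x => ∃ y, M.Adj x y)

lemma mem_supp {V : Type} [Fintype V] (M : SimpleGraph V) (x : V) :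
    x ∈ supp M ↔ ∃ y, M.Adj x y := by simp [supp]

lemma IsLab.card {V : Type} [Fintype V] {k : ℕ} {M : SimpleGraph V} {F : SimpleGraph (Fin k)}
    {i : Fin k → V} (h : IsLab M F i) : (supp M).card = k := by
  have : supp M = Finset.univ.image i := by
    ext x
    rw [mem_supp, h.2.1]; simp
  rw [this, Finset.card_image_of_injective _ h.1]; simp

lemma exists_min_noncol {V : Type} [Fintype V] (H : SimpleGraph V) (hH : ∀ g, ¬ Col H g) :
    ∃ M ≤ H, (∀ g, ¬ Col M g) ∧ ∀ N ≤ M, N ≠ M → ∃ g, Col N g := by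
  obtain ⟨M, hM1, hM2⟩ := exists_minimal_le_of_wellFoundedLT
    (fun M : SimpleGraph V => ∀ g, ¬ Col M g) H hH
  refine ⟨M, hM1, hM2.prop, fun N hN hne => ?_⟩
  by_contra hc
  push Not at hc
  exact hne (le_antisymm hN (hM2.le_of_le hc hN))

lemma exists_lab {V : Type} [Fintype V] (M : SimpleGraph V) :
    ∃ (F : SimpleGraph (Fin (supp M).card)) (i : Fin (supp M).card → V), IsLab M F i := by
  let e := (supp M).equivFin
  refine ⟨M.comap (fun a => (e.symm a : V)), fun a => (e.symm a : V), ?_, ?_, ?_⟩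
  · intro a b hab
    exact e.symm.injective (Subtype.ext hab)
  · intro x
    rw [← mem_supp]
    constructor
    · intro hx; exact ⟨e ⟨x, hx⟩, by simp⟩
    · rintro ⟨a, rfl⟩; exact (e.symm a).2
  · intro a b; rfl

lemma lab_crit {V : Type} {k : ℕ} (M : SimpleGraph V) (hM : ∀ g, ¬ Col M g)
    (hmin : ∀ N ≤ M, N ≠ M → ∃ g, Col N g) (F : SimpleGraph (Fin k)) (i : Fin k → V)
    (h : IsLab M F i) : Critical52 F := by
  constructor
  · constructor
    intro φ
    apply hM (fun x => if hx : ∃ a, i a = x then φ hx.choose else 0)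
    intro x y hxy
    have hx := (h.2.1 x).1 ⟨y, hxy⟩
    have hy := (h.2.1 y).1 ⟨x, hxy.symm⟩
    simp only [hx, hy, dite_true]
    rw [← CA_iff]
    apply φ.map_adj
    rw [← h.2.2, hx.choose_spec, hy.choose_spec]
    exact hxy
  · intro P hP
    let N : SimpleGraph V :=
      { Adj := fun x y => ∃ a b, P.Adj a b ∧ i a = x ∧ i b = y
        symm := ⟨by rintro x y ⟨a, b, hab, rfl, rfl⟩; exact ⟨b, a, hab.symm, rfl, rfl⟩⟩
        loopless := ⟨by
          rintro x ⟨a, b, hab, rfl, hb⟩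
          have := h.1 hb
          subst this
          exact (P.adj_sub hab).ne rfl⟩ }
    have hNM : N ≤ M := by
      rintro x y ⟨a, b, hab, rfl, rfl⟩
      rw [h.2.2]; exact P.adj_sub hab
    have hne : N ≠ M := by
      intro hh
      apply hP
      have hadj : ∀ a b, F.Adj a b → P.Adj a b := by
        intro a b hab
        rw [← h.2.2, ← hh] at hab
        obtain ⟨a', b', hab', h1, h2⟩ := hab
        rw [← h.1 h1, ← h.1 h2]; exact hab'
      apply Subgraph.ext
      · ext a
        simp only [Subgraph.verts_top, Set.mem_univ, iff_true]
        obtain ⟨y, hy⟩ := (h.2.1 (i a)).2 ⟨a, rfl⟩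
        obtain ⟨b, rfl⟩ := (h.2.1 y).1 ⟨_, hy.symm⟩
        rw [h.2.2] at hy
        exact (hadj _ _ hy).fst_mem
      · ext a b
        simp only [Subgraph.top_adj]
        exact ⟨fun hh => P.adj_sub hh, hadj a b⟩
    obtain ⟨g, hg⟩ := hmin N hNM hne
    exact ⟨⟨fun a => g (i a), fun {a b} hab => (CA_iff _ _).2 (hg _ _ ⟨a, b, hab, rfl, rfl⟩)⟩⟩

lemma base {V : Type} [Fintype V] {G : SimpleGraph V} (h : SmallestCex G)
    (H : SimpleGraph V) (hH : ∀ g, ¬ Col H g) (w : V) (hw : ∀ y, ¬ H.Adj w y) :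
    ∃ M ≤ H, (∀ g, ¬ Col M g) ∧ (∀ N ≤ M, N ≠ M → ∃ g, Col N g) ∧
      ((5 * ((supp M).card : ℤ) - 2 * (DD M Finset.univ : ℤ) ≤ 1) ∨
       (∃ i, IsLab M (cycleGraph 3) i) ∨ (∃ i, IsLab M E1 i) ∨ (∃ i, IsLab M E2 i)) := by
  obtain ⟨M, hMH, hM, hmin⟩ := exists_min_noncol H hH
  refine ⟨M, hMH, hM, hmin, ?_⟩
  obtain ⟨F, i, hi⟩ := exists_lab M
  have hF := lab_crit M hM hmin F i hi
  by_cases h3 : Nonempty (F ≃g cycleGraph 3)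
  · obtain ⟨e⟩ := h3
    exact Or.inr (Or.inl ⟨_, hi.iso e⟩)
  by_cases h1 : Nonempty (F ≃g E1)
  · obtain ⟨e⟩ := h1
    exact Or.inr (Or.inr (Or.inl ⟨_, hi.iso e⟩))
  by_cases h2 : Nonempty (F ≃g E2)
  · obtain ⟨e⟩ := h2
    exact Or.inr (Or.inr (Or.inr ⟨_, hi.iso e⟩))
  left
  have hlt : (supp M).card < Fintype.card V := by
    rw [← Finset.card_univ]
    apply Finset.card_lt_card
    rw [Finset.ssubset_univ_iff]
    intro hh
    have : w ∈ supp M := by rw [hh]; simp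
    obtain ⟨y, hy⟩ := (mem_supp _ _).1 this
    exact hw y (hMH hy)
  have := h.2.2.2.2.2 _ F hF (not_nonempty_iff.1 h3) (not_nonempty_iff.1 h1)
    (not_nonempty_iff.1 h2) hlt
  rw [pot_eq, pp, Finset.card_univ, Fintype.card_fin] at this
  rw [hi.DD]
  exact this

end base

/-- Edge lists. -/
def E1b (a b : Fin 10) : Bool :=
  (s(a, b) : Sym2 (Fin 10)) ∈ [s(0,1), s(1,2), s(2,3), s(3,4), s(4,5), s(5,6), s(6,7), s(7,8), s(8,0),
   s(9,0), s(9,3), s(9,6)]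

def E2b (a b : Fin 10) : Bool :=
  (s(a, b) : Sym2 (Fin 10)) ∈ [s(0,1), s(1,2), s(2,3), s(3,4), s(4,0),
   s(1,5), s(5,6), s(6,7), s(7,0), s(3,8), s(8,9), s(9,6)]

lemma E1_adj (a b : Fin 10) : E1.Adj a b ↔ E1b a b = true := by
  have hd : ∀ a b : Fin 10, E1b a b = true → a ≠ b := by decide
  have : E1.Adj a b ↔ (E1b a b = true ∧ a ≠ b) := by
    unfold E1 E1b
    rw [SimpleGraph.fromEdgeSet_adj, decide_eq_true_iff]
    simp only [Set.mem_insert_iff, Set.mem_singleton_iff, List.mem_cons, List.not_mem_nil, or_false]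
  rw [this]
  exact ⟨fun h => h.1, fun h => ⟨h, hd a b h⟩⟩

lemma E2_adj (a b : Fin 10) : E2.Adj a b ↔ E2b a b = true := by
  have hd : ∀ a b : Fin 10, E2b a b = true → a ≠ b := by decide
  have : E2.Adj a b ↔ (E2b a b = true ∧ a ≠ b) := by
    unfold E2 E2b
    rw [SimpleGraph.fromEdgeSet_adj, decide_eq_true_iff]
    simp only [Set.mem_insert_iff, Set.mem_singleton_iff, List.mem_cons, List.not_mem_nil, or_false]
  rw [this]
  exact ⟨fun h => h.1, fun h => ⟨h, hd a b h⟩⟩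

/-- The relevant properties of the exceptional graphs. -/
structure Exc (F : SimpleGraph (Fin 10)) : Prop where
  dd : DD F Finset.univ = 24
  deg3 : ∀ a, ∃ b c d, ∀ x, F.Adj a x → x = b ∨ x = c ∨ x = d
  fold : ∀ a b, F.Adj a b → ∃ s o, ((s = a ∧ o = b) ∨ (s = b ∧ o = a)) ∧
    ∃ n1 n2, F.Adj s n1 ∧ F.Adj s n2 ∧ n1 ≠ o ∧ n2 ≠ o ∧
      (∀ x, F.Adj s x → x = o ∨ x = n1 ∨ x = n2) ∧
      (n1 = n2 ∨ ∃ g : Fin 10 → Fin 5, (∀ x y, x ≠ s → y ≠ s → F.Adj x y → CA (g x) (g y)) ∧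
        g n1 = g n2)

lemma DD_bool (F : SimpleGraph (Fin 10)) (f : Fin 10 → Fin 10 → Bool)
    (h : ∀ a b, F.Adj a b ↔ f a b = true) :
    DD F Finset.univ = (Finset.univ.filter (fun p : Fin 10 × Fin 10 => f p.1 p.2 = true)).card := by
  classical
  unfold DD
  rw [Finset.univ_product_univ]
  congr 1
  ext p
  simp [h]

/-- Colourings for `E1` minus a vertex of the 9-cycle adjacent to the centre. -/
def g1 (s : Fin 10) : Fin 10 → Fin 5 :=
  if s = 0 then ![0, 1, 2, 1, 2, 3, 4, 0, 1, 0]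
  else if s = 3 then ![4, 0, 1, 0, 1, 2, 1, 2, 3, 0]
  else ![1, 2, 3, 4, 0, 1, 0, 1, 2, 0]

def g2 : Fin 10 → Fin 5 := ![0, 1, 0, 4, 0, 2, 1, 0, 3, 2]

/-- The folding condition at a fixed vertex, for a Boolean adjacency function. -/
def FoldOK (E : Fin 10 → Fin 10 → Bool) (g : Fin 10 → Fin 5) (s o n1 n2 : Fin 10) : Prop :=
  E s n1 = true ∧ E s n2 = true ∧ n1 ≠ o ∧ n2 ≠ o ∧
      (∀ x, E s x = true → x = o ∨ x = n1 ∨ x = n2) ∧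
      (n1 = n2 ∨ ((∀ x y, x ≠ s → y ≠ s → E x y = true → CA (g x) (g y)) ∧ g n1 = g n2))

instance (E : Fin 10 → Fin 10 → Bool) (g : Fin 10 → Fin 5) (s o n1 n2 : Fin 10) :
    Decidable (FoldOK E g s o n1 n2) := by
  unfold FoldOK
  infer_instance

lemma exc_fold {F : SimpleGraph (Fin 10)} {E : Fin 10 → Fin 10 → Bool}
    (h : ∀ a b, F.Adj a b ↔ E a b = true) (g : Fin 10 → Fin 10 → Fin 5)
    (key : ∀ a b, E a b = true → (∃ n1 n2, FoldOK E (g a) a b n1 n2) ∨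
      (∃ n1 n2, FoldOK E (g b) b a n1 n2)) :
    ∀ a b, F.Adj a b → ∃ s o, ((s = a ∧ o = b) ∨ (s = b ∧ o = a)) ∧
    ∃ n1 n2, F.Adj s n1 ∧ F.Adj s n2 ∧ n1 ≠ o ∧ n2 ≠ o ∧
      (∀ x, F.Adj s x → x = o ∨ x = n1 ∨ x = n2) ∧
      (n1 = n2 ∨ ∃ g : Fin 10 → Fin 5, (∀ x y, x ≠ s → y ≠ s → F.Adj x y → CA (g x) (g y)) ∧
        g n1 = g n2) := by
  simp only [h]
  intro a b hab
  rcases key a b hab with ⟨n1, n2, h2, h3, h4, h5, h6, h7⟩ | ⟨n1, n2, h2, h3, h4, h5, h6, h7⟩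
  · exact ⟨a, b, Or.inl ⟨rfl, rfl⟩, n1, n2, h2, h3, h4, h5, h6, h7.imp id (fun h => ⟨_, h⟩)⟩
  · exact ⟨b, a, Or.inr ⟨rfl, rfl⟩, n1, n2, h2, h3, h4, h5, h6, h7.imp id (fun h => ⟨_, h⟩)⟩

lemma exc1 : Exc E1 where
  dd := by rw [DD_bool _ _ E1_adj]; decide +kernel
  deg3 := by simp only [E1_adj]; decide +kernel
  fold := exc_fold E1_adj g1 (by decide +kernel)

lemma exc2 : Exc E2 where
  dd := by rw [DD_bool _ _ E2_adj]; decide +kernel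
  deg3 := by simp only [E2_adj]; decide +kernel
  fold := exc_fold E2_adj (fun _ => g2) (by decide +kernel)


lemma Y_bound : ∀ Y : Finset (Fin 5), Y.Nonempty →
    2 * ((Y ×ˢ Y).filter (fun p => CA p.1 p.2)).card + 5 ≤ 5 * Y.card := by
  decide +kernel

section CLsec
open Classical

/-- Pairs of a graph in `Q` that are not inside `Z`. -/
noncomputable def outP {V : Type} (K : SimpleGraph V) (Z Q : Finset V) : Finset (V × V) :=
  (Q ×ˢ Q).filter (fun p => K.Adj p.1 p.2 ∧ ¬ (p.1 ∈ Z ∧ p.2 ∈ Z))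

lemma DD_split {V : Type} (K : SimpleGraph V) (Z Q : Finset V) :
    DD K Q = DD K (Q ∩ Z) + (outP K Z Q).card := by
  unfold DD outP
  rw [← Finset.card_union_of_disjoint]
  · congr 1
    ext ⟨a, b⟩
    simp only [Finset.mem_filter, Finset.mem_product, Finset.mem_union, Finset.mem_inter]
    tauto
  · rw [Finset.disjoint_left]
    rintro ⟨a, b⟩ h1 h2
    simp only [Finset.mem_filter, Finset.mem_product, Finset.mem_inter] at h1 h2
    tauto

lemma inj_bound {V : Type} (M : SimpleGraph V) (X : Finset V) (φ : V → Fin 5) (hne : X.Nonempty)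
    (hinj : ∀ x ∈ X, ∀ y ∈ X, φ x = φ y → x = y)
    (hM : ∀ x ∈ X, ∀ y ∈ X, M.Adj x y → CA (φ x) (φ y)) : 5 ≤ pp M X := by
  have h1 := Y_bound (X.image φ) (hne.image φ)
  have h2 : (X.image φ).card = X.card := Finset.card_image_of_injOn (fun x hx y hy => hinj x hx y hy)
  have h3 : DD M X ≤ (((X.image φ) ×ˢ (X.image φ)).filter (fun p => CA p.1 p.2)).card := by
    unfold DD
    apply Finset.card_le_card_of_injOn (fun p => (φ p.1, φ p.2))
    · rintro ⟨a, b⟩ hp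
      simp only [Finset.coe_filter, Finset.mem_product, Set.mem_ofPred_eq] at hp ⊢
      exact ⟨⟨Finset.mem_image_of_mem _ hp.1.1, Finset.mem_image_of_mem _ hp.1.2⟩,
        hM _ hp.1.1 _ hp.1.2 hp.2⟩
    · rintro ⟨a, b⟩ hp ⟨c, d⟩ hq hh
      simp only [Finset.coe_filter, Finset.mem_product, Set.mem_ofPred_eq] at hp hq
      simp only [Prod.mk.injEq] at hh
      rw [hinj _ hp.1.1 _ hq.1.1 hh.1, hinj _ hp.1.2 _ hq.1.2 hh.2]
  unfold pp
  omega

lemma inj_card {V : Type} (X : Finset V) (φ : V → Fin 5)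
    (hinj : ∀ x ∈ X, ∀ y ∈ X, φ x = φ y → x = y) : X.card ≤ 5 := by
  have h2 : (X.image φ).card = X.card := Finset.card_image_of_injOn (fun x hx y hy => hinj x hx y hy)
  have := Finset.card_le_univ (X.image φ)
  simp at this
  omega

lemma exists_rep {V : Type} (Z : Finset V) (φ : V → Fin 5) :
    ∃ f : V → V, (∀ x, x ∉ Z → f x = x) ∧ (∀ x ∈ Z, f x ∈ Z ∧ φ (f x) = φ x) ∧
      (∀ x ∈ Z, ∀ y ∈ Z, φ x = φ y → f x = f y) := by
  have : ∀ c : Fin 5, ∃ r : V → V, ∀ x ∈ Z, φ x = c → (r x ∈ Z ∧ φ (r x) = c ∧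
      ∀ y ∈ Z, φ y = c → r x = r y) := by
    intro c
    by_cases hc : ∃ z ∈ Z, φ z = c
    · obtain ⟨z, hz, hzc⟩ := hc
      exact ⟨fun _ => z, fun x _ _ => ⟨hz, hzc, fun _ _ _ => rfl⟩⟩
    · push Not at hc
      exact ⟨id, fun x hx hxc => absurd hxc (hc x hx)⟩
  choose r hr using this
  refine ⟨fun x => if x ∈ Z then r (φ x) x else x, fun x hx => by simp [hx], fun x hx => ?_,
    fun x hx y hy hxy => ?_⟩
  · simp only [hx, if_true]
    exact ⟨(hr _ x hx rfl).1, (hr _ x hx rfl).2.1⟩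
  · simp only [hx, hy, if_true]
    rw [hxy]
    exact (hr _ x hx hxy).2.2 y hy rfl

/-- Collapsing argument. -/
lemma CL {V : Type} [Fintype V] {G : SimpleGraph V} (h : SmallestCex G) (K : SimpleGraph V)
    (hKG : K ≤ G) (Z : Finset V) (φ : V → Fin 5)
    (hφ : ∀ x ∈ Z, ∀ y ∈ Z, K.Adj x y → CA (φ x) (φ y))
    (hni : ∃ x ∈ Z, ∃ y ∈ Z, x ≠ y ∧ φ x = φ y)
    (hno : ∀ g, Col K g → (∀ x ∈ Z, ∀ y ∈ Z, φ x = φ y → g x = g y) → False) :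
    ∃ Q, Z ⊂ Q ∧ (∀ q ∈ Q, q ∈ Z ∨ ∃ y, K.Adj q y) ∧
      (pp K Q ≤ pp K Z - 4 ∨
       (pp K Q ≤ pp K Z - 3 ∧ Z.card + 5 ≤ Q.card ∧
         ∀ t ∈ Q, t ∉ Z → 4 ≤ (nb K t Q).card → pp K Q ≤ pp K Z - 7) ∨
       (pp K Q ≤ pp K Z - 2 ∧ Q.card ≤ Z.card + 3 ∧
         ∃ a b c, a ≠ b ∧ a ≠ c ∧ b ≠ c ∧ Q = Z ∪ {a, b, c} ∧
          (∀ x ∈ ({a, b, c} : Finset V), ∀ y ∈ ({a, b, c} : Finset V), x ≠ y →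
            ∃ x' y', K.Adj x' y' ∧ (x' = x ∨ (x ∈ Z ∧ x' ∈ Z ∧ φ x' = φ x)) ∧
              (y' = y ∨ (y ∈ Z ∧ y' ∈ Z ∧ φ y' = φ y))))) := by
  obtain ⟨f, hf1, hf2, hf3⟩ := exists_rep Z φ
  let H : SimpleGraph V :=
    { Adj := fun a b => a ≠ b ∧ ∃ a' b', K.Adj a' b' ∧ f a' = a ∧ f b' = b
      symm := ⟨by rintro a b ⟨hab, a', b', h1, h2, h3⟩; exact ⟨hab.symm, b', a', h1.symm, h3, h2⟩⟩
      loopless := ⟨fun a ha => ha.1 rfl⟩ }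
  have hfZ : ∀ x, f x ∈ Z ↔ x ∈ Z := by
    intro x
    by_cases hx : x ∈ Z
    · simp [hx, (hf2 x hx).1]
    · rw [hf1 x hx]
  have hlift : ∀ x x', f x' = x → (x' = x ∨ (x ∈ Z ∧ x' ∈ Z ∧ φ x' = φ x)) := by
    rintro x x' rfl
    by_cases hx : x' ∈ Z
    · exact Or.inr ⟨(hf2 _ hx).1, hx, (hf2 _ hx).2.symm⟩
    · left; rw [hf1 _ hx]
  -- edges never collapse
  have hcol : ∀ x y, K.Adj x y → f x ≠ f y := by
    intro x y hxy he
    by_cases hx : x ∈ Z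
    · have hy : y ∈ Z := by rw [← hfZ, ← he, hfZ]; exact hx
      have := CA_ne (hφ x hx y hy hxy)
      apply this
      rw [← (hf2 x hx).2, he, (hf2 y hy).2]
    · have hy : y ∉ Z := by rw [← hfZ, ← he, hfZ]; exact hx
      rw [hf1 x hx, hf1 y hy] at he
      exact hxy.ne he
  have hH : ∀ g, ¬ Col H g := by
    intro g hg
    apply hno (fun x => g (f x))
    · intro x y hxy
      exact hg _ _ ⟨hcol x y hxy, x, y, hxy, rfl, rfl⟩
    · intro x hx y hy hxy
      simp only [hf3 x hx y hy hxy]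
  have hidem : ∀ x, f (f x) = f x := by
    intro x
    by_cases hx : x ∈ Z
    · exact hf3 _ (hf2 x hx).1 _ hx (hf2 x hx).2
    · rw [hf1 x hx, hf1 x hx]
  have hw : ∃ w, f w ≠ w := by
    obtain ⟨x, hx, y, hy, hne, he⟩ := hni
    by_contra hc
    push Not at hc
    have := hf3 x hx y hy he
    rw [hc, hc] at this
    exact hne this
  obtain ⟨w, hw⟩ := hw
  obtain ⟨M, hMH, hM, hmin, htri⟩ := base h H hH w (by
    rintro y ⟨_, a', b', _, h1, _⟩
    apply hw
    rw [← h1, hidem])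
  have hML : ∀ a b, M.Adj a b → ∃ a' b', K.Adj a' b' ∧ f a' = a ∧ f b' = b :=
    fun a b hab => (hMH hab).2
  have hMf : ∀ a b, M.Adj a b → f a = a := by
    intro a b hab
    obtain ⟨a', b', _, h1, _⟩ := hML a b hab
    rw [← h1, hidem]
  set W := supp M with hW
  set X := W ∩ Z with hX
  set Q := Z ∪ W with hQ
  have hXinj : ∀ x ∈ X, ∀ y ∈ X, φ x = φ y → x = y := by
    intro x hx y hy hxy
    rw [hX, Finset.mem_inter, hW, mem_supp] at hx hy
    obtain ⟨⟨x', hx'⟩, hxZ⟩ := hx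
    obtain ⟨⟨y', hy'⟩, hyZ⟩ := hy
    rw [← hMf x x' hx', ← hMf y y' hy']
    exact hf3 x hxZ y hyZ hxy
  have hXCA : ∀ x ∈ Z, ∀ y ∈ Z, M.Adj x y → CA (φ x) (φ y) := by
    intro x hx y hy hxy
    obtain ⟨a', b', h1, rfl, rfl⟩ := hML x y hxy
    rw [hfZ] at hx hy
    rw [(hf2 _ hx).2, (hf2 _ hy).2]
    exact hφ _ hx _ hy h1
  have hXne : X.Nonempty := by
    by_contra hc
    rw [Finset.not_nonempty_iff_eq_empty] at hc
    have hdis : ∀ a b, M.Adj a b → a ∉ Z := by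
      intro a b hab haZ
      have : a ∈ X := by rw [hX, Finset.mem_inter, hW, mem_supp]; exact ⟨⟨b, hab⟩, haZ⟩
      rw [hc] at this; simp at this
    have hMK : M ≤ K := by
      intro a b hab
      obtain ⟨a', b', h1, h2, h3⟩ := hML a b hab
      have ha := hdis a b hab
      have hb := hdis b a hab.symm
      rw [← h2, hfZ] at ha
      rw [← h3, hfZ] at hb
      rw [hf1 _ ha] at h2
      rw [hf1 _ hb] at h3
      rw [← h2, ← h3]; exact h1
    have hMG : M = G := by
      by_contra hne
      obtain ⟨g, hg⟩ := crit_min h.1 (hMK.trans hKG) hne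
      exact hM g hg
    obtain ⟨z, hz, _⟩ := hni
    obtain ⟨y, hy⟩ := crit_nbr h.1 z
    rw [← hMG] at hy
    exact hdis z y hy hz
  have hWZ : ¬ W ⊆ Z := by
    intro hc
    apply hM φ
    intro a b hab
    exact hXCA a (hc ((mem_supp _ _).2 ⟨b, hab⟩)) b (hc ((mem_supp _ _).2 ⟨a, hab.symm⟩)) hab
  have hZQ : Z ⊂ Q := by
    rw [Finset.ssubset_iff_subset_ne]
    refine ⟨Finset.subset_union_left, fun hc => hWZ ?_⟩
    rw [hc]; exact Finset.subset_union_right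
  have hQnb : ∀ q ∈ Q, q ∈ Z ∨ ∃ y, K.Adj q y := by
    intro q hq
    by_cases hqZ : q ∈ Z
    · exact Or.inl hqZ
    right
    have hqW : q ∈ W := by
      rw [hQ, Finset.mem_union] at hq
      tauto
    obtain ⟨y, hy⟩ := (mem_supp _ _).1 hqW
    obtain ⟨a', b', h1, h2, h3⟩ := hML _ _ hy
    rw [← h2, hfZ] at hqZ
    rw [hf1 _ hqZ] at h2
    rw [← h2]
    exact ⟨_, h1⟩
  -- counting
  choose! l hl using (fun p : V × V => (fun hp => by
    obtain ⟨a', b', h1, h2, h3⟩ := hML p.1 p.2 hp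
    exact ⟨(a', b'), h1, h2, h3⟩ :
    M.Adj p.1 p.2 → ∃ q : V × V, K.Adj q.1 q.2 ∧ f q.1 = p.1 ∧ f q.2 = p.2))
  have hWQ : ∀ a a', a ∈ W → f a' = a → a' ∈ Q := by
    intro a a' ha h1
    rw [hQ, Finset.mem_union]
    by_cases haZ : a' ∈ Z
    · exact Or.inl haZ
    · rw [hf1 _ haZ] at h1
      rw [h1]; exact Or.inr ha
  have hcnt : ∀ S ⊆ outP K Z Q, (∀ p ∈ outP M Z W, l p ∉ S) →
      (outP M Z W).card + S.card ≤ (outP K Z Q).card := by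
    intro S hS hdis
    have hinj : Set.InjOn l (outP M Z W) := by
      rintro p hp q hq hpq
      simp only [outP, Finset.coe_filter, Set.mem_ofPred_eq] at hp hq
      obtain ⟨_, h1, h2⟩ := hl p hp.2.1
      obtain ⟨_, h3, h4⟩ := hl q hq.2.1
      rw [hpq] at h1 h2
      exact Prod.ext (h1.symm.trans h3) (h2.symm.trans h4)
    rw [← Finset.card_image_of_injOn hinj, ← Finset.card_union_of_disjoint]
    · apply Finset.card_le_card
      apply Finset.union_subset _ hS
      intro q hq
      obtain ⟨p, hp, rfl⟩ := Finset.mem_image.1 hq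
      simp only [outP, Finset.mem_filter, Finset.mem_product] at hp ⊢
      obtain ⟨h0, h1, h2⟩ := hl p hp.2.1
      refine ⟨⟨hWQ _ _ hp.1.1 h1, hWQ _ _ hp.1.2 h2⟩, h0, ?_⟩
      rw [← hfZ, ← hfZ (l p).2, h1, h2]
      exact hp.2.2
    · rw [Finset.disjoint_left]
      intro q hq
      obtain ⟨p, hp, rfl⟩ := Finset.mem_image.1 hq
      exact hdis p hp
  have hDM : DD M Finset.univ = DD M X + (outP M Z W).card := by
    rw [← DD_split]
    unfold DD
    congr 1
    ext ⟨a, b⟩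
    simp only [Finset.mem_filter, Finset.mem_product, Finset.mem_univ, true_and]
    refine ⟨fun hab => ⟨⟨(mem_supp _ _).2 ⟨b, hab⟩, (mem_supp _ _).2 ⟨a, hab.symm⟩⟩, hab⟩, fun hh => hh.2⟩
  have hDK : DD K Q = DD K Z + (outP K Z Q).card := by
    have := DD_split K Z Q
    rwa [show Q ∩ Z = Z by rw [hQ]; simp] at this
  have hcard : Q.card + X.card = Z.card + W.card := by
    rw [hX, Finset.inter_comm]
    exact Finset.card_union_add_card_inter Z W
  have hX5 := inj_bound M X φ hXne hXinj (fun x hx y hy =>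
    hXCA x (Finset.mem_inter.1 hx).2 y (Finset.mem_inter.1 hy).2)
  have hXc := inj_card X φ hXinj
  have hfin : ∀ S ⊆ outP K Z Q, (∀ p ∈ outP M Z W, l p ∉ S) →
      pp K Q ≤ pp K Z + (5 * (W.card : ℤ) - 2 * (DD M Finset.univ : ℤ)) - 5 - 2 * S.card := by
    intro S hS hdis
    have := hcnt S hS hdis
    unfold pp at hX5 ⊢
    omega
  have hfin0 := hfin ∅ (by simp) (by simp)
  simp only [Finset.card_empty] at hfin0
  refine ⟨Q, hZQ, hQnb, ?_⟩
  have hE : ∀ (F : SimpleGraph (Fin 10)) (i : Fin 10 → V), Exc F → IsLab M F i →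
      (pp K Q ≤ pp K Z - 3 ∧ Z.card + 5 ≤ Q.card ∧
         ∀ t ∈ Q, t ∉ Z → 4 ≤ (nb K t Q).card → pp K Q ≤ pp K Z - 7) := by
    intro F i hF hi
    have hWc : W.card = 10 := hi.card
    have hDc : DD M Finset.univ = 24 := by rw [hi.DD, hF.dd]
    rw [hWc, hDc] at hfin0
    refine ⟨by omega, by omega, ?_⟩
    intro t htQ htZ ht4
    have htW : t ∈ W := by
      rw [hQ, Finset.mem_union] at htQ
      tauto
    obtain ⟨t0, ht0⟩ := (mem_supp _ _).1 htW
    obtain ⟨a, rfl⟩ := (hi.2.1 t).1 ⟨_, ht0⟩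
    obtain ⟨b, c, d, hbcd⟩ := hF.deg3 a
    have hM3 : ∀ x, M.Adj (i a) x → x = i b ∨ x = i c ∨ x = i d := by
      intro x hx
      obtain ⟨x, rfl⟩ := (hi.2.1 x).1 ⟨_, hx.symm⟩
      rcases hbcd x ((hi.2.2 _ _).1 hx) with rfl | rfl | rfl <;> simp
    have hft : f (i a) = i a := hf1 _ htZ
    have hex : ∀ r : V → V, ∃ y ∈ nb K (i a) Q, ∀ x, M.Adj (i a) x → r x ≠ y := by
      intro r
      by_contra hc
      push Not at hc
      have : nb K (i a) Q ⊆ {r (i b), r (i c), r (i d)} := by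
        intro y hy
        obtain ⟨x, hx, rfl⟩ := hc y hy
        rcases hM3 x hx with rfl | rfl | rfl <;> simp
      have h1 := Finset.card_le_card this
      have h2 : ({r (i b), r (i c), r (i d)} : Finset V).card ≤ 3 := Finset.card_le_three
      omega
    obtain ⟨y, hy, hyM⟩ := hex (fun x => (l (i a, x)).2)
    obtain ⟨z, hz, hzM⟩ := hex (fun x => (l (x, i a)).1)
    simp only [nb, Finset.mem_filter] at hy hz
    have hS : ({(i a, y), (z, i a)} : Finset (V × V)).card = 2 := by
      apply Finset.card_pair
      intro he
      simp only [Prod.mk.injEq] at he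
      rw [he.2] at hy
      exact hy.2.ne rfl
    have := hfin {(i a, y), (z, i a)} (by
      intro p hp
      simp only [Finset.mem_insert, Finset.mem_singleton] at hp
      simp only [outP, Finset.mem_filter, Finset.mem_product]
      rcases hp with rfl | rfl
      · exact ⟨⟨htQ, hy.1⟩, hy.2, fun hh => htZ hh.1⟩
      · exact ⟨⟨hz.1, htQ⟩, hz.2.symm, fun hh => htZ hh.2⟩) (by
      rintro ⟨p, q⟩ hp hpS
      simp only [outP, Finset.mem_filter, Finset.mem_product] at hp
      obtain ⟨h0, h1, h2⟩ := hl (p, q) hp.2.1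
      simp only [Finset.mem_insert, Finset.mem_singleton] at hpS
      rcases hpS with he | he
      · rw [he] at h1
        simp only at h1
        rw [hft] at h1
        subst h1
        exact hyM q hp.2.1 (by rw [he])
      · rw [he] at h2
        simp only at h2
        rw [hft] at h2
        subst h2
        exact hzM p hp.2.1.symm (by rw [he]))
    rw [hS, hWc, hDc] at this
    omega
  rcases htri with h1 | ⟨i, hi⟩ | ⟨i, hi⟩ | ⟨i, hi⟩
  · left; omega
  · right; right
    have hWc : W.card = 3 := hi.card
    have hd3 : DD (cycleGraph 3) Finset.univ = 6 := by
      unfold DD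
      rw [Finset.univ_product_univ]
      have : ∀ p : Fin 3 × Fin 3, (cycleGraph 3).Adj p.1 p.2 ↔ p.1 ≠ p.2 := by decide
      simp only [this]
      decide
    have hadj3 : ∀ a b : Fin 3, a ≠ b → (cycleGraph 3).Adj a b := by decide
    have hDc : DD M Finset.univ = 6 := by rw [hi.DD, hd3]
    rw [hWc, hDc] at hfin0
    have hWeq : W = {i 0, i 1, i 2} := by
      ext x
      rw [hW, mem_supp, hi.2.1]
      simp only [Finset.mem_insert, Finset.mem_singleton]
      constructor
      · rintro ⟨a, rfl⟩
        fin_cases a <;> simp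
      · rintro (rfl | rfl | rfl) <;> exact ⟨_, rfl⟩
    refine ⟨by omega, by omega, i 0, i 1, i 2, fun he => ?_, fun he => ?_, fun he => ?_, ?_, ?_⟩
    · exact absurd (hi.1 he) (by decide)
    · exact absurd (hi.1 he) (by decide)
    · exact absurd (hi.1 he) (by decide)
    · rw [hQ, hWeq]
    · rw [← hWeq]
      intro x hx y hy hxy
      rw [hW, mem_supp, hi.2.1] at hx hy
      obtain ⟨a, rfl⟩ := hx
      obtain ⟨b, rfl⟩ := hy
      have hab : a ≠ b := fun he => hxy (by rw [he])
      obtain ⟨a', b', h1, h2, h3⟩ := hML _ _ ((hi.2.2 a b).2 (hadj3 a b hab))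
      exact ⟨a', b', h1, hlift _ _ h2, hlift _ _ h3⟩
  · right; left; exact hE _ _ exc1 hi
  · right; left; exact hE _ _ exc2 hi

end CLsec


lemma Y_bound_eq : ∀ Y : Finset (Fin 5), Y.Nonempty →
    5 * Y.card ≤ 2 * ((Y ×ˢ Y).filter (fun p => CA p.1 p.2)).card + 5 →
      Y.card = 1 ∨ (Y.card = 5 ∧ ((Y ×ˢ Y).filter (fun p => CA p.1 p.2)).card = 10) := by
  decide +kernel

section Lsec
open Classical

lemma inj_bound_eq {V : Type} (M : SimpleGraph V) (X : Finset V) (φ : V → Fin 5) (hne : X.Nonempty)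
    (hinj : ∀ x ∈ X, ∀ y ∈ X, φ x = φ y → x = y)
    (hM : ∀ x ∈ X, ∀ y ∈ X, M.Adj x y → CA (φ x) (φ y)) (hp : pp M X ≤ 5) :
    X.card = 1 ∨ (X.card = 5 ∧ ∀ x ∈ X, ∀ y ∈ X, CA (φ x) (φ y) → M.Adj x y) := by
  have h2 : (X.image φ).card = X.card := Finset.card_image_of_injOn (fun x hx y hy => hinj x hx y hy)
  set P := (X ×ˢ X).filter (fun p => M.Adj p.1 p.2) with hP
  have hPinj : Set.InjOn (fun p : V × V => (φ p.1, φ p.2)) P := by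
    rintro ⟨a, b⟩ hp ⟨c, d⟩ hq hh
    simp only [hP, Finset.coe_filter, Finset.mem_product, Set.mem_ofPred_eq] at hp hq
    simp only [Prod.mk.injEq] at hh
    rw [hinj _ hp.1.1 _ hq.1.1 hh.1, hinj _ hp.1.2 _ hq.1.2 hh.2]
  have hsub : P.image (fun p => (φ p.1, φ p.2)) ⊆
      ((X.image φ) ×ˢ (X.image φ)).filter (fun p => CA p.1 p.2) := by
    intro q hq
    obtain ⟨⟨a, b⟩, hp, rfl⟩ := Finset.mem_image.1 hq
    simp only [hP, Finset.mem_filter, Finset.mem_product] at hp ⊢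
    exact ⟨⟨Finset.mem_image_of_mem _ hp.1.1, Finset.mem_image_of_mem _ hp.1.2⟩,
        hM _ hp.1.1 _ hp.1.2 hp.2⟩
  have hc := Finset.card_le_card hsub
  rw [Finset.card_image_of_injOn hPinj] at hc
  have hd : DD M X = P.card := rfl
  unfold pp at hp
  rcases Y_bound_eq (X.image φ) (hne.image φ) (by omega) with h5 | ⟨h5, h10⟩
  · left; omega
  · right
    refine ⟨by omega, fun x hx y hy hxy => ?_⟩
    have heq := Finset.eq_of_subset_of_card_le hsub (by
      rw [Finset.card_image_of_injOn hPinj, h10]; omega)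
    have : (φ x, φ y) ∈ ((X.image φ) ×ˢ (X.image φ)).filter (fun p => CA p.1 p.2) := by
      simp only [Finset.mem_filter, Finset.mem_product]
      exact ⟨⟨Finset.mem_image_of_mem _ hx, Finset.mem_image_of_mem _ hy⟩, hxy⟩
    rw [← heq] at this
    obtain ⟨⟨a, b⟩, hab, he⟩ := Finset.mem_image.1 this
    simp only [hP, Finset.mem_filter, Finset.mem_product] at hab
    simp only [Prod.mk.injEq] at he
    rw [← hinj _ hab.1.1 _ hx he.1, ← hinj _ hab.1.2 _ hy he.2]
    exact hab.2

variable {V : Type} [Fintype V] {G : SimpleGraph V}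

lemma pot2 (h : SmallestCex G) : 2 ≤ pp G Finset.univ := by
  rw [← pot_eq]; exact h.2.2.2.2.1

lemma Lstep (h : SmallestCex G) (Q : Finset V) (hu : Q ≠ Finset.univ) :
    ∃ φ : V → Fin 5, (∀ x ∈ Q, ∀ y ∈ Q, G.Adj x y → CA (φ x) (φ y)) ∧
    ((∀ x ∈ Q, ∀ y ∈ Q, φ x = φ y → x = y) ∨
    ∃ Q', Q ⊂ Q' ∧
      (pp G Q' ≤ pp G Q - 4 ∨
       (pp G Q' ≤ pp G Q - 3 ∧ Q.card + 5 ≤ Q'.card ∧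
         ∀ t ∈ Q', t ∉ Q → 4 ≤ (nb G t Q').card → pp G Q' ≤ pp G Q - 7) ∨
       (pp G Q' ≤ pp G Q - 2 ∧ Q'.card ≤ Q.card + 3))) := by
  obtain ⟨w, hw⟩ : ∃ w, w ∉ Q := by
    by_contra hc
    push Not at hc
    exact hu (Finset.eq_univ_iff_forall.2 hc)
  let K : SimpleGraph V :=
    { Adj := fun x y => G.Adj x y ∧ x ∈ Q ∧ y ∈ Q
      symm := ⟨fun x y hh => ⟨hh.1.symm, hh.2.2, hh.2.1⟩⟩
      loopless := ⟨fun x hh => hh.1.ne rfl⟩ }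
  obtain ⟨φ, hφ⟩ := crit_min h.1 (K := K) (fun x y hh => hh.1) (by
    intro he
    obtain ⟨y, hy⟩ := crit_nbr h.1 w
    rw [← he] at hy
    exact hw hy.2.1)
  have hφ' : ∀ x ∈ Q, ∀ y ∈ Q, G.Adj x y → CA (φ x) (φ y) := fun x hx y hy hxy => hφ x y ⟨hxy, hx, hy⟩
  refine ⟨φ, hφ', ?_⟩
  by_cases hinj : ∀ x ∈ Q, ∀ y ∈ Q, φ x = φ y → x = y
  · exact Or.inl hinj
  right
  push Not at hinj
  obtain ⟨x, hx, y, hy, hxy, hne⟩ := hinj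
  obtain ⟨Q', h1, -, h2⟩ := CL h G le_rfl Q φ hφ' ⟨x, hx, y, hy, hne, hxy⟩
    (fun g hg _ => not_col_of_isEmpty h.1.1 g hg)
  refine ⟨Q', h1, ?_⟩
  rcases h2 with h2 | h2 | ⟨h2, h3, -⟩
  · exact Or.inl h2
  · exact Or.inr (Or.inl h2)
  · exact Or.inr (Or.inr ⟨h2, h3⟩)

lemma LL (h : SmallestCex G) : ∀ (n : ℕ) (Q : Finset V), Fintype.card V - Q.card = n →
    Q.Nonempty → Q ≠ Finset.univ → 4 ≤ pp G Q := by
  intro n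
  induction n using Nat.strong_induction_on with
  | _ n ih =>
    intro Q hn hne hu
    obtain ⟨φ, hφ, hinj | ⟨Q', hQ', hpp⟩⟩ := Lstep h Q hu
    · have := inj_bound G Q φ hne hinj hφ
      omega
    · have h2 : pp G Q' ≤ pp G Q - 2 := by
        rcases hpp with h1 | h1 | h1 <;> omega
      by_cases hu' : Q' = Finset.univ
      · have := pot2 h
        rw [hu'] at h2
        omega
      · have hc := Finset.card_lt_card hQ'
        have hc' := Finset.card_le_univ Q'
        have := ih (Fintype.card V - Q'.card) (by omega) Q' rfl (hne.mono hQ'.subset) hu'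
        omega

lemma L4 (h : SmallestCex G) (Q : Finset V) (hne : Q.Nonempty) (hu : Q ≠ Finset.univ) :
    4 ≤ pp G Q := LL h _ Q rfl hne hu

lemma L2 (h : SmallestCex G) (Q : Finset V) (hne : Q.Nonempty) : 2 ≤ pp G Q := by
  by_cases hu : Q = Finset.univ
  · rw [hu]; exact pot2 h
  · have := L4 h Q hne hu
    omega

lemma ne_univ_of_card {Q : Finset V} (hc : Q.card < Fintype.card V) : Q ≠ Finset.univ := by
  rintro rfl
  rw [Finset.card_univ] at hc
  omega

lemma L5 (h : SmallestCex G) (Q : Finset V) (hne : Q.Nonempty) (hc : Q.card + 5 ≤ Fintype.card V) :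
    5 ≤ pp G Q := by
  obtain ⟨φ, hφ, hinj | ⟨Q', hQ', hpp⟩⟩ := Lstep h Q (ne_univ_of_card (by omega))
  · exact inj_bound G Q φ hne hinj hφ
  · have hne' := hne.mono hQ'.subset
    have h2 := L2 h Q' hne'
    rcases hpp with h1 | h1 | h1
    · omega
    · omega
    · have := L4 h Q' hne' (ne_univ_of_card (by omega))
      omega

lemma L6 (h : SmallestCex G) (Q : Finset V) (hne : Q.Nonempty) (hc : Q.card + 5 ≤ Fintype.card V)
    (v : V) (hv : v ∉ Q) (hv4 : 4 ≤ (nb G v Finset.univ).card) :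
    6 ≤ pp G Q ∨ Q.card = 1 ∨ (Q.card = 5 ∧ ∃ φ : V → Fin 5,
      (∀ x ∈ Q, ∀ y ∈ Q, φ x = φ y → x = y) ∧
      (∀ x ∈ Q, ∀ y ∈ Q, G.Adj x y ↔ CA (φ x) (φ y))) := by
  obtain ⟨φ, hφ, hinj | ⟨Q', hQ', hpp⟩⟩ := Lstep h Q (ne_univ_of_card (by omega))
  · by_cases h6 : 6 ≤ pp G Q
    · exact Or.inl h6
    · right
      rcases inj_bound_eq G Q φ hne hinj hφ (by omega) with h1 | ⟨h1, h2⟩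
      · exact Or.inl h1
      · exact Or.inr ⟨h1, φ, hinj, fun x hx y hy => ⟨hφ x hx y hy, h2 x hx y hy⟩⟩
  · left
    have hne' := hne.mono hQ'.subset
    have h2 := L2 h Q' hne'
    rcases hpp with h1 | h1 | h1
    · omega
    · by_cases hu : Q' = Finset.univ
      · have := h1.2.2 v (by simp [hu]) hv (by rw [hu]; exact hv4)
        omega
      · have := L4 h Q' hne' hu
        omega
    · have := L4 h Q' hne' (ne_univ_of_card (by omega))
      omega

end Lsec


section Rsec
open Classical

/-- The graph with all edges meeting `T` removed. -/
def cutT {V : Type} (G : SimpleGraph V) (T : Finset V) : SimpleGraph V where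
  Adj x y := G.Adj x y ∧ x ∉ T ∧ y ∉ T
  symm := ⟨fun _ _ h => ⟨h.1.symm, h.2.2, h.2.1⟩⟩
  loopless := ⟨fun _ h => h.1.ne rfl⟩

variable {V : Type} [Fintype V] {G : SimpleGraph V}

lemma cutT_le (T : Finset V) : cutT G T ≤ G := fun _ _ h => h.1

lemma cutT_col (h : SmallestCex G) {T : Finset V} {v : V} (hv : v ∈ T) : ∃ g, Col (cutT G T) g := by
  apply crit_min h.1 (cutT_le T)
  intro he
  obtain ⟨y, hy⟩ := crit_nbr h.1 v
  rw [← he] at hy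
  exact hy.2.1 hv

lemma pp_cutT {T Q : Finset V} (hd : ∀ x ∈ Q, x ∉ T) : pp (cutT G T) Q = pp G Q := by
  unfold pp
  rw [DD_congr (K := cutT G T) (K' := G)]
  intro x hx y hy
  exact ⟨fun hh => hh.1, fun hh => ⟨hh, hd x hx, hd y hy⟩⟩

lemma card_disj {T Q : Finset V} (hd : ∀ x ∈ Q, x ∉ T) : Q.card + T.card ≤ Fintype.card V := by
  rw [← Finset.card_union_of_disjoint (Finset.disjoint_left.2 (fun x => hd x))]
  exact Finset.card_le_univ _

/-- The configuration around a `(2,2,2,1)`-vertex. -/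
structure Gad (G : SimpleGraph V) (v : V) (T : Finset V) (u : Fin 3 → V) (u4 : V) : Prop where
  vT : v ∈ T
  v4 : 4 ≤ (nb G v Finset.univ).card
  T8 : 8 ≤ T.card
  uT : ∀ i, u i ∉ T
  u4T : u4 ∉ T
  une : ∀ i, u i ≠ u4
  unb : ∀ i, ∃ t ∈ T, G.Adj (u i) t
  u4nb : ∃ t ∈ T, G.Adj u4 t
  bad : ∀ g, Col (cutT G T) g → (∀ i j, i ≠ j → g (u i) ≠ g (u j)) ∧ ∀ i, ¬ CA (g (u i)) (g u4)

lemma nb_pair {K : SimpleGraph V} {s x y : V} {A : Finset V} (hxy : x ≠ y) (hx : x ∈ A) (hy : y ∈ A)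
    (h1 : K.Adj s x) (h2 : K.Adj s y) (hall : ∀ z ∈ A, K.Adj s z → z = x ∨ z = y) :
    (nb K s A).card = 2 := by
  have : nb K s A = {x, y} := by
    ext z
    simp only [nb, Finset.mem_filter, Finset.mem_insert, Finset.mem_singleton]
    constructor
    · rintro ⟨hz, hh⟩; exact hall z hz hh
    · rintro (rfl | rfl)
      · exact ⟨hx, h1⟩
      · exact ⟨hy, h2⟩
  rw [this, Finset.card_pair hxy]

lemma R3 (h : SmallestCex G) {v : V} {T : Finset V} (hv : v ∈ T)
    (hv4 : 4 ≤ (nb G v Finset.univ).card) (hT8 : 8 ≤ T.card) {p q : V} 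
    (hpn : ∃ t ∈ T, G.Adj p t) (hqn : ∃ t ∈ T, G.Adj q t)
    (M : SimpleGraph V) (hMA : ∀ x ∈ supp M, x ∉ T)
    (hMG : ∀ x y, M.Adj x y → G.Adj x y ∨ (x = p ∧ y = q) ∨ (x = q ∧ y = p))
    (hMpq : M.Adj p q) (hGpq : ¬ G.Adj p q)
    (F : SimpleGraph (Fin 10)) (hF : Exc F) (ι : Fin 10 → V) (hι : IsLab M F ι) : False := by
  have hp : p ∈ supp M := (mem_supp _ _).2 ⟨_, hMpq⟩
  have hq : q ∈ supp M := (mem_supp _ _).2 ⟨_, hMpq.symm⟩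
  have hAc : (supp M).card = 10 := hι.card
  have hAT := card_disj hMA
  have hvA : v ∉ supp M := fun hh => hMA v hh hv
  have h6 : 6 ≤ pp G (supp M) := by
    rcases L6 h (supp M) ⟨p, hp⟩ (by omega) v hvA hv4 with h6 | h6 | h6
    · exact h6
    · omega
    · omega
  have hDM : DD M Finset.univ = 24 := by rw [hι.DD, hF.dd]
  -- the induced graph
  set PM := (Finset.univ ×ˢ Finset.univ).filter (fun e : V × V => M.Adj e.1 e.2) with hPM
  set PG := ((supp M) ×ˢ (supp M)).filter (fun e : V × V => G.Adj e.1 e.2) with hPG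
  have hDG : DD G (supp M) = PG.card := rfl
  have hDM' : PM.card = 24 := hDM
  have hsub : PM \ {(p, q), (q, p)} ⊆ PG := by
    rintro ⟨x, y⟩ hxy
    simp only [hPM, hPG, Finset.mem_sdiff, Finset.mem_filter, Finset.mem_product, Finset.mem_univ,
      true_and, Finset.mem_insert, Finset.mem_singleton, Prod.mk.injEq, not_or] at hxy ⊢
    refine ⟨⟨(mem_supp _ _).2 ⟨_, hxy.1⟩, (mem_supp _ _).2 ⟨_, hxy.1.symm⟩⟩, ?_⟩
    rcases hMG x y hxy.1 with h1 | h1 | h1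
    · exact h1
    · exact absurd h1 hxy.2.1
    · exact absurd h1 hxy.2.2
  have hc22 : 22 ≤ (PM \ {(p, q), (q, p)}).card := by
    have h1 := Finset.le_card_sdiff {(p, q), (q, p)} PM
    have h2 : ({(p, q), (q, p)} : Finset (V × V)).card ≤ 2 := Finset.card_le_two
    omega
  have hPGc : PG.card ≤ 22 := by unfold pp at h6; omega
  have hPGe := Finset.eq_of_subset_of_card_le hsub (by omega)
  have hGM : ∀ x ∈ supp M, ∀ y ∈ supp M, G.Adj x y →
      M.Adj x y ∧ ¬ (x = p ∧ y = q) ∧ ¬ (x = q ∧ y = p) := by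
    intro x hx y hy hxy
    have : (x, y) ∈ PG := by
      simp only [hPG, Finset.mem_filter, Finset.mem_product]
      exact ⟨⟨hx, hy⟩, hxy⟩
    rw [← hPGe] at this
    simpa only [hPM, Finset.mem_sdiff, Finset.mem_filter, Finset.mem_product, Finset.mem_univ,
      true_and, Finset.mem_insert, Finset.mem_singleton, Prod.mk.injEq, not_or] using this
  have hpp6 : pp G (supp M) = 6 := by
    have := Finset.card_le_card hsub
    unfold pp at h6 ⊢; omega
  obtain ⟨a, ha⟩ := (hι.2.1 p).1 ⟨_, hMpq⟩
  obtain ⟨b, hb⟩ := (hι.2.1 q).1 ⟨_, hMpq.symm⟩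
  have hab : F.Adj a b := by rw [← hι.2.2, ha, hb]; exact hMpq
  obtain ⟨s, o, hso, n1, n2, hn1, hn2, hn1o, hn2o, hall, hfold⟩ := hF.fold a b hab
  have hmem : ∀ c, ι c ∈ supp M := fun c => (mem_supp _ _).2 ((hι.2.1 _).2 ⟨c, rfl⟩)
  have hGadj : ∀ c, F.Adj s c → c ≠ o → G.Adj (ι s) (ι c) := by
    intro c hc hco
    rcases hMG _ _ ((hι.2.2 s c).2 hc) with h1 | ⟨h1, h2⟩ | ⟨h1, h2⟩
    · exact h1
    · rw [← ha] at h1; rw [← hb] at h2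
      have h1 := hι.1 h1
      have h2 := hι.1 h2
      rcases hso with ⟨h3, h4⟩ | ⟨h3, h4⟩
      · exact absurd (h2.trans h4.symm) hco
      · exact absurd (h1.symm.trans h3) hab.ne
    · rw [← hb] at h1; rw [← ha] at h2
      have h1 := hι.1 h1
      have h2 := hι.1 h2
      rcases hso with ⟨h3, h4⟩ | ⟨h3, h4⟩
      · exact absurd (h3.symm.trans h1) hab.ne
      · exact absurd (h2.trans h4.symm) hco
  have hGnb : ∀ x ∈ supp M, G.Adj (ι s) x → x = ι n1 ∨ x = ι n2 := by
    intro x hx hsx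
    obtain ⟨h1, h2, h3⟩ := hGM _ (hmem s) x hx hsx
    obtain ⟨c, rfl⟩ := (hι.2.1 x).1 ((mem_supp _ _).1 hx)
    rcases hall c ((hι.2.2 _ _).1 h1) with rfl | rfl | rfl
    · exfalso
      rcases hso with ⟨h4, h5⟩ | ⟨h4, h5⟩
      · exact h2 ⟨by rw [h4, ha], by rw [h5, hb]⟩
      · exact h3 ⟨by rw [h4, hb], by rw [h5, ha]⟩
    · simp
    · simp
  have hsT : ∃ t ∈ T, G.Adj (ι s) t := by
    rcases hso with ⟨h4, h5⟩ | ⟨h4, h5⟩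
    · rw [h4, ha]; exact hpn
    · rw [h4, hb]; exact hqn
  set S := ι s with hS
  set N1 := ι n1 with hN1
  set N2 := ι n2 with hN2
  have hSN1 : G.Adj S N1 := hGadj n1 hn1 hn1o
  have hSN2 : G.Adj S N2 := hGadj n2 hn2 hn2o
  set Z := (supp M).erase S with hZ
  have hSZ : S ∉ Z := by simp [hZ]
  have hAZ : supp M = insert S Z := (Finset.insert_erase (hmem s)).symm
  have hN1Z : N1 ∈ Z := Finset.mem_erase.2 ⟨hSN1.ne', hmem n1⟩
  have hN2Z : N2 ∈ Z := Finset.mem_erase.2 ⟨hSN2.ne', hmem n2⟩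
  have hZA : ∀ x ∈ Z, x ∈ supp M := fun x hx => Finset.mem_of_mem_erase hx
  have hZc : Z.card = 9 := by rw [hZ, Finset.card_erase_of_mem (hmem s), hAc]
  have hvZ : v ∉ Z := fun hh => hvA (hZA v hh)
  have hins := pp_insert G Z S hSZ
  rw [← hAZ, hpp6] at hins
  rcases hfold with hnn | ⟨g, hg1, hg2⟩
  · have h1 : (nb G S Z).card = 1 := by
      rw [Finset.card_eq_one]
      refine ⟨N1, ?_⟩
      ext z
      simp only [nb, Finset.mem_filter, Finset.mem_singleton]
      constructor
      · rintro ⟨hz, hh⟩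
        rcases hGnb z (hZA z hz) hh with h1 | h1
        · exact h1
        · rw [h1, hN2, hN1, hnn]
      · rintro rfl
        exact ⟨hN1Z, hSN1⟩
    rcases L6 h Z ⟨_, hN1Z⟩ (by omega) v hvZ hv4 with h6 | h6 | h6
    · omega
    · omega
    · omega
  by_cases hnn : N1 = N2
  · have h1 : (nb G S Z).card = 1 := by
      rw [Finset.card_eq_one]
      refine ⟨N1, ?_⟩
      ext z
      simp only [nb, Finset.mem_filter, Finset.mem_singleton]
      constructor
      · rintro ⟨hz, hh⟩
        rcases hGnb z (hZA z hz) hh with h1 | h1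
        · exact h1
        · rw [h1, hnn]
      · rintro rfl
        exact ⟨hN1Z, hSN1⟩
    rcases L6 h Z ⟨_, hN1Z⟩ (by omega) v hvZ hv4 with h6 | h6 | h6
    · omega
    · omega
    · omega
  have hpp9 : pp G Z = 9 := by
    rw [nb_pair hnn hN1Z hN2Z hSN1 hSN2 (fun z hz => hGnb z (hZA z hz))] at hins
    norm_num at hins
    omega
  let K1 : SimpleGraph V :=
    { Adj := fun x y => G.Adj x y ∧ ¬ (x = S ∧ y = N1) ∧ ¬ (x = N1 ∧ y = S)
      symm := ⟨fun x y hh => ⟨hh.1.symm, fun h1 => hh.2.2 ⟨h1.2, h1.1⟩, fun h1 => hh.2.1 ⟨h1.2, h1.1⟩⟩⟩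
      loopless := ⟨fun x hh => hh.1.ne rfl⟩ }
  have hK1 : K1 ≤ G := fun x y hh => hh.1
  have hK1S : ∀ Q : Finset V, S ∉ Q → pp K1 Q = pp G Q := by
    intro Q hQ
    unfold pp
    rw [DD_congr (K := K1) (K' := G)]
    intro x hx y hy
    refine ⟨fun hh => hh.1, fun hh => ⟨hh, ?_, ?_⟩⟩
    · rintro ⟨rfl, _⟩; exact hQ hx
    · rintro ⟨_, rfl⟩; exact hQ hy
  have hK1in : ∀ Q : Finset V, S ∈ Q → N1 ∈ Q → pp G Q ≤ pp K1 Q - 4 := by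
    intro Q hSQ hNQ
    have : DD K1 Q + 2 ≤ DD G Q := by
      have h2 : ({(S, N1), (N1, S)} : Finset (V × V)).card = 2 := by
        apply Finset.card_pair
        intro he
        simp only [Prod.mk.injEq] at he
        exact hSN1.ne he.1
      unfold DD
      rw [← h2, ← Finset.card_union_of_disjoint]
      · apply Finset.card_le_card
        rintro ⟨x, y⟩ hxy
        simp only [Finset.mem_union, Finset.mem_filter, Finset.mem_product, Finset.mem_insert,
          Finset.mem_singleton, Prod.mk.injEq] at hxy ⊢
        rcases hxy with ⟨h1, h2⟩ | ⟨rfl, rfl⟩ | ⟨rfl, rfl⟩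
        · exact ⟨h1, h2.1⟩
        · exact ⟨⟨hSQ, hNQ⟩, hSN1⟩
        · exact ⟨⟨hNQ, hSQ⟩, hSN1.symm⟩
      · rw [Finset.disjoint_left]
        rintro ⟨x, y⟩ hxy hxy'
        simp only [Finset.mem_filter, Finset.mem_product, Finset.mem_insert,
          Finset.mem_singleton, Prod.mk.injEq] at hxy hxy'
        rcases hxy' with h1 | h1
        · exact hxy.2.2.1 h1
        · exact hxy.2.2.2 h1
    unfold pp
    omega
  have hinv : ∀ c, Function.invFun ι (ι c) = c := Function.leftInverse_invFun hι.1
  obtain ⟨Q, hZQ, -, hcase⟩ := CL h K1 hK1 Z (fun x => g (Function.invFun ι x)) (by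
      intro x hx y hy hxy
      obtain ⟨c, rfl⟩ := (hι.2.1 x).1 ((mem_supp _ _).1 (hZA x hx))
      obtain ⟨d, rfl⟩ := (hι.2.1 y).1 ((mem_supp _ _).1 (hZA y hy))
      simp only [hinv]
      apply hg1
      · rintro rfl; exact hSZ hx
      · rintro rfl; exact hSZ hy
      · rw [← hι.2.2]
        exact (hGM _ (hmem c) _ (hmem d) hxy.1).1)
    ⟨N1, hN1Z, N2, hN2Z, hnn, by simp only [hN1, hN2, hinv]; exact hg2⟩
    (by
      intro g' hg' hcon
      have he := hcon N1 hN1Z N2 hN2Z (by simp only [hN1, hN2, hinv]; exact hg2)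
      have hS2 : CA (g' S) (g' N2) := hg' _ _ ⟨hSN2, fun hh => hnn hh.2.symm, fun hh => hSN1.ne hh.1⟩
      rw [← he] at hS2
      apply not_col_of_isEmpty h.1.1 g'
      intro x y hxy
      by_cases h1 : x = S ∧ y = N1
      · rw [h1.1, h1.2]; exact hS2
      by_cases h2 : x = N1 ∧ y = S
      · rw [h2.1, h2.2]; exact CA_symm hS2
      exact hg' x y ⟨hxy, h1, h2⟩)
  rw [hK1S Z hSZ, hpp9] at hcase
  have hQne : Q.Nonempty := ⟨N1, hZQ.subset hN1Z⟩
  by_cases hSQ : S ∈ Q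
  · have h1 := hK1in Q hSQ (hZQ.subset hN1Z)
    have h2 := L2 h Q hQne
    rcases hcase with hc | ⟨hc, _, hc'⟩ | ⟨hc, hc', _⟩
    · omega
    · by_cases hu : Q = Finset.univ
      · have := hc' v (by simp [hu]) hvZ (by
          rw [hu]
          have : nb K1 v Finset.univ = nb G v Finset.univ := by
            ext z
            simp only [nb, Finset.mem_filter, Finset.mem_univ, true_and]
            refine ⟨fun hh => hh.1, fun hh => ⟨hh, ?_, ?_⟩⟩
            · rintro ⟨h3, _⟩; exact hvA (h3 ▸ hmem s)
            · rintro ⟨h3, _⟩; exact hvA (h3 ▸ hmem n1)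
          rw [this]; exact hv4)
        omega
      · have := L4 h Q hQne hu
        omega
    · have := L4 h Q hQne (ne_univ_of_card (by omega))
      omega
  · rw [hK1S Q hSQ] at hcase
    have h3 := pp_insert_le2 G Q S N1 N2 hSQ (hZQ.subset hN1Z) hSN1 (hZQ.subset hN2Z) hSN2 hnn
    have hne' : (insert S Q).Nonempty := ⟨S, by simp⟩
    by_cases hu : insert S Q = Finset.univ
    · obtain ⟨t, htT, ht⟩ := hsT
      have htQ : t ∈ Q := by
        have : t ∈ insert S Q := by rw [hu]; simp
        rcases Finset.mem_insert.1 this with h4 | h4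
        · exact absurd htT (h4 ▸ hMA _ (hmem s))
        · exact h4
      have htA : t ∉ supp M := fun hh => hMA t hh htT
      have h4 := pp_insert_le3 G Q S N1 N2 t hSQ (hZQ.subset hN1Z) hSN1 (hZQ.subset hN2Z) hSN2
        htQ ht hnn (fun hh => htA (hh ▸ hmem n1)) (fun hh => htA (hh ▸ hmem n2))
      have h5 := L2 h _ hne'
      rcases hcase with hc | ⟨hc, _, hc'⟩ | ⟨hc, hc', _⟩ <;> omega
    · have h4 := L4 h _ hne' hu
      rcases hcase with hc | ⟨hc, _, hc'⟩ | ⟨hc, hc', _⟩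
      · omega
      · omega
      · have h5 := L5 h (insert S Q) hne' (by
          rw [Finset.card_insert_of_notMem hSQ]; omega)
        omega

lemma CA_common : ∀ a b : Fin 5, a ≠ b → ¬ CA a b → ∃ c, CA c a ∧ CA c b := by decide

lemma R2 (h : SmallestCex G) {v : V} {T : Finset V} {u : Fin 3 → V} {u4 : V}
    (hg : Gad G v T u u4) (i : Fin 3) :
    ∃ x, (cutT G T).Adj x (u i) ∧ (cutT G T).Adj x u4 := by
  obtain ⟨g0, hg0⟩ := cutT_col h hg.vT
  have hnadj : ¬ G.Adj (u i) u4 := by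
    intro hh
    exact (hg.bad g0 hg0).2 i (hg0 _ _ ⟨hh, hg.uT i, hg.u4T⟩)
  let H : SimpleGraph V :=
    { Adj := fun x y => (cutT G T).Adj x y ∨ (x = u i ∧ y = u4) ∨ (x = u4 ∧ y = u i)
      symm := ⟨by
        rintro x y (hh | hh | hh)
        · exact Or.inl hh.symm
        · exact Or.inr (Or.inr ⟨hh.2, hh.1⟩)
        · exact Or.inr (Or.inl ⟨hh.2, hh.1⟩)⟩
      loopless := ⟨by
        rintro x (hh | ⟨h1, h2⟩ | ⟨h1, h2⟩)
        · exact hh.ne rfl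
        · exact hg.une i (h1.symm.trans h2)
        · exact hg.une i (h2.symm.trans h1)⟩ }
  have hH : ∀ g, ¬ Col H g := by
    intro g hc
    exact (hg.bad g (fun x y hh => hc x y (Or.inl hh))).2 i (hc _ _ (Or.inr (Or.inl ⟨rfl, rfl⟩)))
  have hHT : ∀ x y, H.Adj x y → x ∉ T := by
    rintro x y (hh | ⟨rfl, _⟩ | ⟨rfl, _⟩)
    · exact hh.2.1
    · exact hg.uT i
    · exact hg.u4T
  obtain ⟨M, hMH, hM, -, htri⟩ := base h H hH v (fun y hy => hHT v y hy hg.vT)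
  have hMpq : M.Adj (u i) u4 := by
    by_contra hc
    apply hM g0
    intro x y hxy
    rcases hMH hxy with hh | ⟨rfl, rfl⟩ | ⟨rfl, rfl⟩
    · exact hg0 _ _ hh
    · exact absurd hxy hc
    · exact absurd hxy.symm hc
  have hMA : ∀ x ∈ supp M, x ∉ T := by
    intro x hx
    obtain ⟨y, hy⟩ := (mem_supp _ _).1 hx
    exact hHT x y (hMH hy)
  have hMG : ∀ x y, M.Adj x y → G.Adj x y ∨ (x = u i ∧ y = u4) ∨ (x = u4 ∧ y = u i) := by
    intro x y hxy
    rcases hMH hxy with hh | hh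
    · exact Or.inl hh.1
    · exact Or.inr hh
  have hp : u i ∈ supp M := (mem_supp _ _).2 ⟨_, hMpq⟩
  have hq : u4 ∈ supp M := (mem_supp _ _).2 ⟨_, hMpq.symm⟩
  rcases htri with h1 | ⟨j, hj⟩ | ⟨j, hj⟩ | ⟨j, hj⟩
  · have hD : DD M Finset.univ ≤ DD G (supp M) + 2 := by
      have h2 : ({(u i, u4), (u4, u i)} : Finset (V × V)).card ≤ 2 := Finset.card_le_two
      have : (Finset.univ ×ˢ Finset.univ).filter (fun e : V × V => M.Adj e.1 e.2) ⊆
          ((supp M) ×ˢ (supp M)).filter (fun e : V × V => G.Adj e.1 e.2) ∪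
            {(u i, u4), (u4, u i)} := by
        rintro ⟨x, y⟩ hxy
        simp only [Finset.mem_filter, Finset.mem_product, Finset.mem_univ,
          true_and, Finset.mem_union, Finset.mem_insert, Finset.mem_singleton,
          Prod.mk.injEq] at hxy ⊢
        rcases hMG x y hxy with hh | hh
        · exact Or.inl ⟨⟨(mem_supp _ _).2 ⟨_, hxy⟩, (mem_supp _ _).2 ⟨_, hxy.symm⟩⟩, hh⟩
        · exact Or.inr hh
      have h3 := Finset.card_le_card this
      have h4 := Finset.card_union_le (((supp M) ×ˢ (supp M)).filter (fun e : V × V => G.Adj e.1 e.2))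
        {(u i, u4), (u4, u i)}
      unfold DD
      omega
    have hAT := card_disj hMA
    have hT8 := hg.T8
    rcases L6 h (supp M) ⟨_, hp⟩ (by omega) v (fun hh => hMA v hh hg.vT) hg.v4 with
      h6 | h6 | ⟨h6, φ, hinj, hφ⟩
    · unfold pp at h6; omega
    · obtain ⟨z, hz⟩ := Finset.card_eq_one.1 h6
      rw [hz, Finset.mem_singleton] at hp hq
      exact absurd (hp.trans hq.symm) (hg.une i)
    · have hn : ¬ CA (φ (u i)) (φ u4) := fun hh => hnadj ((hφ _ hp _ hq).2 hh)
      obtain ⟨c, hc1, hc2⟩ := CA_common _ _ (fun hh => hg.une i (hinj _ hp _ hq hh)) hn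
      have himg : (supp M).image φ = Finset.univ := by
        apply Finset.eq_univ_of_card
        rw [Finset.card_image_of_injOn (fun x hx y hy => hinj x hx y hy), h6]
        simp
      have : c ∈ (supp M).image φ := by rw [himg]; simp
      obtain ⟨x, hx, rfl⟩ := Finset.mem_image.1 this
      exact ⟨x, ⟨(hφ _ hx _ hp).2 hc1, hMA x hx, hg.uT i⟩, ⟨(hφ _ hx _ hq).2 hc2, hMA x hx, hg.u4T⟩⟩
  · obtain ⟨a, ha⟩ := (hj.2.1 (u i)).1 ⟨_, hMpq⟩
    obtain ⟨b, hb⟩ := (hj.2.1 u4).1 ⟨_, hMpq.symm⟩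
    have hab : a ≠ b := by
      rintro rfl
      exact hg.une i (ha.symm.trans hb)
    have hth : ∀ a b : Fin 3, a ≠ b → ∃ c, c ≠ a ∧ c ≠ b := by decide
    have hadj3 : ∀ a b : Fin 3, a ≠ b → (cycleGraph 3).Adj a b := by decide
    obtain ⟨c, hca, hcb⟩ := hth a b hab
    have hc1 : j c ≠ u i := fun hh => hca (hj.1 (hh.trans ha.symm))
    have hc2 : j c ≠ u4 := fun hh => hcb (hj.1 (hh.trans hb.symm))
    have key : ∀ d, d ≠ c → (cutT G T).Adj (j c) (j d) := by
      intro d hd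
      rcases hMH ((hj.2.2 c d).2 (hadj3 c d hd.symm)) with hh | hh | hh
      · exact hh
      · exact absurd hh.1 hc1
      · exact absurd hh.1 hc2
    exact ⟨j c, ha ▸ key a hca.symm, hb ▸ key b hcb.symm⟩
  · exact (R3 h hg.vT hg.v4 hg.T8 (hg.unb i) hg.u4nb M hMA hMG hMpq hnadj _ exc1 j hj).elim
  · exact (R3 h hg.vT hg.v4 hg.T8 (hg.unb i) hg.u4nb M hMA hMG hMpq hnadj _ exc2 j hj).elim

end Rsec


lemma CA_notri : ∀ a b c : Fin 5, CA a b → CA b c → CA a c → False := by decide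
lemma CA_three : ∀ a p q r : Fin 5, CA a p → CA a q → CA a r → p ≠ q → p ≠ r → q ≠ r → False := by
  decide

section Psec
open Classical

variable {V : Type} [Fintype V] {G : SimpleGraph V}

lemma notri (h : SmallestCex G) {T : Finset V} {v : V} (hv : v ∈ T) {a b c : V}
    (h1 : (cutT G T).Adj a b) (h2 : (cutT G T).Adj b c) (h3 : (cutT G T).Adj a c) : False := by
  obtain ⟨g, hg⟩ := cutT_col h hv
  exact CA_notri _ _ _ (hg _ _ h1) (hg _ _ h2) (hg _ _ h3)

/-- A partially coloured set of small potential outside `T`. -/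
structure Ok (G : SimpleGraph V) (T Z : Finset V) (ψ : V → Fin 5) (n : ℕ) : Prop where
  out : ∀ z ∈ Z, z ∉ T
  card5 : 5 ≤ Z.card
  card : Z.card ≤ n
  pot : pp G Z ≤ Z.card
  hom : ∀ x ∈ Z, ∀ y ∈ Z, G.Adj x y → CA (ψ x) (ψ y)

lemma Ok.ext (h : SmallestCex G) {T Z : Finset V} {v : V} (hv : v ∈ T) {ψ : V → Fin 5} {n : ℕ}
    (ho : Ok G T Z ψ n) (hn : n ≤ 6) (y z : V) (c : Fin 5) (hy : y ∉ T) (hz : z ∈ Z)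
    (hyz : G.Adj y z) (hc : CA c (ψ z)) (hyZ : y ∈ Z → ψ y = c) :
    Ok G T (insert y Z) (Function.update ψ y c) (n + 1) := by
  by_cases hm : y ∈ Z
  · rw [Finset.insert_eq_of_mem hm, ← hyZ hm, Function.update_eq_self]
    exact ⟨ho.out, ho.card5, ho.card.trans (by omega), ho.pot, ho.hom⟩
  have hout : ∀ z ∈ insert y Z, z ∉ T := by
    intro w hw
    rcases Finset.mem_insert.1 hw with rfl | hw
    · exact hy
    · exact ho.out w hw
  have hu : insert y Z ≠ Finset.univ := by
    intro hu
    exact hout v (by rw [hu]; simp) hv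
  have h1 := ho.card
  have h2 := ho.card5
  have h3 := ho.pot
  have huniq : ∀ w ∈ Z, G.Adj y w → w = z := by
    intro w hw hyw
    by_contra hne
    have := pp_insert_le2 G Z y w z hm hw hyw hz hyz hne
    have := L4 h (insert y Z) ⟨y, by simp⟩ hu
    omega
  have hcd := Finset.card_insert_of_notMem hm
  refine ⟨hout, by omega, by omega, ?_, ?_⟩
  · have := pp_insert_le G Z y z hm hz hyz
    rw [hcd]; push_cast; omega
  · have hself : Function.update ψ y c y = c := by simp
    have hoth : ∀ w ∈ Z, Function.update ψ y c w = ψ w := by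
      intro w hw
      apply Function.update_of_ne
      rintro rfl; exact hm hw
    intro p hp q hq hpq
    rcases Finset.mem_insert.1 hp with e1 | hp2
    · rcases Finset.mem_insert.1 hq with e2 | hq2
      · exact absurd (e1.trans e2.symm) hpq.ne
      · rw [e1] at hpq ⊢
        rw [hself, hoth q hq2, huniq q hq2 hpq]; exact hc
    · rcases Finset.mem_insert.1 hq with e2 | hq2
      · rw [e2] at hpq ⊢
        rw [hself, hoth p hp2, huniq p hp2 hpq.symm]; exact CA_symm hc
      · rw [hoth p hp2, hoth q hq2]; exact ho.hom p hp2 q hq2 hpq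

lemma Ok.fin (h : SmallestCex G) {T Z : Finset V} {v : V} (hv : v ∈ T) (hT : 8 ≤ T.card)
    (hv4 : 4 ≤ (nb G v Finset.univ).card) {ψ : V → Fin 5}
    (ho : Ok G T Z ψ 7) (x y : V) (hx : x ∈ Z) (hy : y ∈ Z) (hxy : x ≠ y) (he : ψ x = ψ y) :
    ∃ g, Col (cutT G T) g ∧ ∀ x ∈ Z, ∀ y ∈ Z, ψ x = ψ y → g x = g y := by
  by_contra hc
  push Not at hc
  obtain ⟨Q, hZQ, hQ, hcase⟩ := CL h (cutT G T) (cutT_le T) Z ψ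
    (fun x hx y hy hxy => ho.hom x hx y hy hxy.1) ⟨x, hx, y, hy, hxy, he⟩ (by
      intro g hg hcon
      obtain ⟨x, hx, y, hy, h1, h2⟩ := hc g hg
      exact h2 (hcon x hx y hy h1))
  have hout : ∀ q ∈ Q, q ∉ T := by
    intro q hq
    rcases hQ q hq with h1 | ⟨w, hw⟩
    · exact ho.out q h1
    · exact hw.2.1
  rw [pp_cutT hout, pp_cutT ho.out] at hcase
  have h1 : pp G Q ≤ pp G Z - 2 := by
    rcases hcase with h1 | h1 | h1 <;> omega
  have h2 := ho.pot
  have h3 := ho.card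
  have h4 := ho.card5
  have h5 := Finset.card_lt_card hZQ
  have h6 := card_disj hout
  rcases L6 h Q ⟨x, hZQ.subset hx⟩ (by omega) v (fun hh => hout v hh hv) hv4 with h7 | h7 | h7
  · omega
  · omega
  · omega

/-- The colouring of a 5-cycle. -/
noncomputable def psiC (a b c d : V) : V → Fin 5 := fun y =>
  if y = a then 0 else if y = b then 1 else if y = c then 2 else if y = d then 3 else 4

/-- The data of the final case: a 5-cycle `u4 (x i) s t (x j)`. -/
structure Fin5 (G : SimpleGraph V) (T : Finset V) (u x : Fin 3 → V) (u4 s t : V)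
    (i j k : Fin 3) : Prop where
  xu : ∀ m, (cutT G T).Adj (x m) (u m)
  xu4 : ∀ m, (cutT G T).Adj (x m) u4
  xij : x i ≠ x j
  ij : i ≠ j
  ik : i ≠ k
  jk : j ≠ k
  as : (cutT G T).Adj (x i) s
  st : (cutT G T).Adj s t
  tb : (cutT G T).Adj t (x j)
  s4 : s ≠ u4
  t4 : t ≠ u4

lemma Fin5.swap {T : Finset V} {u x : Fin 3 → V} {u4 s t : V} {i j k : Fin 3}
    (hf : Fin5 G T u x u4 s t i j k) : Fin5 G T u x u4 t s j i k :=
  ⟨hf.xu, hf.xu4, hf.xij.symm, hf.ij.symm, hf.jk, hf.ik, hf.tb.symm, hf.st.symm, hf.as.symm,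
    hf.t4, hf.s4⟩

/-- The vertex set of the 5-cycle. -/
noncomputable def setC (a b c d e : V) : Finset V := insert e (insert d (insert c (insert b {a})))

lemma mem_setC (a b c d e y : V) : y ∈ setC a b c d e ↔ y = a ∨ y = b ∨ y = c ∨ y = d ∨ y = e := by
  unfold setC
  simp only [Finset.mem_insert, Finset.mem_singleton]
  tauto

lemma Fin5.facts (h : SmallestCex G) {v : V} {T : Finset V} (hv : v ∈ T) 
    {u x : Fin 3 → V} {u4 s t : V} {i j k : Fin 3} (hf : Fin5 G T u x u4 s t i j k) :
    s ≠ x i ∧ s ≠ x j ∧ t ≠ x i ∧ t ≠ x j ∧ s ≠ t ∧ x i ≠ u4 ∧ x j ≠ u4 := by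
  refine ⟨hf.as.ne', ?_, ?_, hf.tb.ne, hf.st.ne, (hf.xu4 i).ne, (hf.xu4 j).ne⟩
  · intro he
    exact notri h hv (hf.xu4 i) (hf.xu4 j).symm (he ▸ hf.as)
  · intro he
    exact notri h hv (hf.xu4 i) (hf.xu4 j).symm (he ▸ hf.tb)

lemma Fin5.ok (h : SmallestCex G) {v : V} {T : Finset V} (hv : v ∈ T) (hu4 : u4 ∉ T)
    {u x : Fin 3 → V} {s t : V} {i j k : Fin 3} (hf : Fin5 G T u x u4 s t i j k) :
    Ok G T (setC u4 (x i) s t (x j)) (psiC u4 (x i) s t) 5 ∧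
      psiC u4 (x i) s t u4 = 0 ∧ psiC u4 (x i) s t (x i) = 1 ∧ psiC u4 (x i) s t s = 2 ∧
      psiC u4 (x i) s t t = 3 ∧ psiC u4 (x i) s t (x j) = 4 := by
  obtain ⟨n1, n2, n3, n4, n5, n6, n7⟩ := hf.facts h hv
  have n8 := hf.s4
  have n9 := hf.t4
  have n10 := hf.xij
  have p0 : psiC u4 (x i) s t u4 = 0 := by simp [psiC]
  have p1 : psiC u4 (x i) s t (x i) = 1 := by simp [psiC, n6]
  have p2 : psiC u4 (x i) s t s = 2 := by simp [psiC, n8, n1]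
  have p3 : psiC u4 (x i) s t t = 3 := by simp [psiC, n9, n3, n5.symm]
  have p4 : psiC u4 (x i) s t (x j) = 4 := by simp [psiC, n7, n10.symm, n2.symm, n4.symm]
  refine ⟨?_, p0, p1, p2, p3, p4⟩
  have hout : ∀ z ∈ setC u4 (x i) s t (x j), z ∉ T := by
    intro z hz
    rw [mem_setC] at hz
    rcases hz with rfl | rfl | rfl | rfl | rfl
    · exact hu4
    · exact hf.as.2.1
    · exact hf.st.2.1
    · exact hf.tb.2.1
    · exact hf.tb.2.2
  have e1 : x i ∉ ({u4} : Finset V) := by simp [n6]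
  have e2 : s ∉ insert (x i) ({u4} : Finset V) := by simp [n8, n1]
  have e3 : t ∉ insert s (insert (x i) ({u4} : Finset V)) := by simp [n9, n3, n5.symm]
  have e4 : x j ∉ insert t (insert s (insert (x i) ({u4} : Finset V))) := by
    simp [n7, n10.symm, n2.symm, n4.symm]
  have hcard : (setC u4 (x i) s t (x j)).card = 5 := by
    unfold setC
    rw [Finset.card_insert_of_notMem e4, Finset.card_insert_of_notMem e3,
      Finset.card_insert_of_notMem e2, Finset.card_insert_of_notMem e1, Finset.card_singleton]
  refine ⟨hout, by omega, by omega, ?_, ?_⟩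
  · have q0 := pp_singleton G u4
    have q1 := pp_insert_le G {u4} (x i) u4 e1 (by simp) (hf.xu4 i).1
    have q2 := pp_insert_le G _ s (x i) e2 (by simp) hf.as.1.symm
    have q3 := pp_insert_le G _ t s e3 (by simp) hf.st.1.symm
    have q4 := pp_insert_le2 G _ (x j) u4 t e4 (by simp) (hf.xu4 j).1 (by simp) hf.tb.1.symm n9.symm
    rw [hcard]
    unfold setC
    push_cast
    omega
  · have key : ∀ y ∈ setC u4 (x i) s t (x j), ∀ z ∈ setC u4 (x i) s t (x j),
        (cutT G T).Adj y z → CA (psiC u4 (x i) s t y) (psiC u4 (x i) s t z) := by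
      intro y hy z hz hyz
      rw [mem_setC] at hy hz
      have a1 := hf.xu4 i
      have a2 := hf.xu4 j
      have a3 := hf.as
      have a4 := hf.st
      have a5 := hf.tb
      rcases hy with rfl | rfl | rfl | rfl | rfl <;> rcases hz with rfl | rfl | rfl | rfl | rfl <;>
        first
        | (simp only [p0, p1, p2, p3, p4]; decide)
        | exact absurd rfl hyz.ne
        | exact (notri h hv a1 hyz a3).elim
        | exact (notri h hv a1 hyz.symm a3).elim
        | exact (notri h hv a2 hyz a5.symm).elim
        | exact (notri h hv a2 hyz.symm a5.symm).elim
        | exact (notri h hv a3 a4 hyz).elim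
        | exact (notri h hv a3 a4 hyz.symm).elim
        | exact (notri h hv a1 a2.symm hyz).elim
        | exact (notri h hv a1 a2.symm hyz.symm).elim
        | exact (notri h hv a4 a5 hyz).elim
        | exact (notri h hv a4 a5 hyz.symm).elim
    intro y hy z hz hyz
    exact key y hy z hz ⟨hyz, hout y hy, hout z hz⟩

lemma Gad.n4 (h : SmallestCex G) {v : V} {T : Finset V} {u : Fin 3 → V} {u4 : V}
    (hg : Gad G v T u u4) (m : Fin 3) : ¬ (cutT G T).Adj (u m) u4 := by
  obtain ⟨g, hgc⟩ := cutT_col h hg.vT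
  intro hh
  exact (hg.bad g hgc).2 m (hgc _ _ hh)

lemma Gad.unn (h : SmallestCex G) {v : V} {T : Finset V} {u : Fin 3 → V} {u4 : V}
    (hg : Gad G v T u u4) (m n : Fin 3) (hmn : m ≠ n) : u m ≠ u n := by
  obtain ⟨g, hgc⟩ := cutT_col h hg.vT
  intro hh
  exact (hg.bad g hgc).1 m n hmn (by rw [hh])

lemma core1 (h : SmallestCex G) {v : V} {T : Finset V} {u x : Fin 3 → V} {u4 s t : V}
    (hg : Gad G v T u u4) {i j k : Fin 3} (hf : Fin5 G T u x u4 s t i j k)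
    (hkj : x k ≠ x j) (hut : u j ≠ t) : False := by
  obtain ⟨hok, p0, p1, p2, p3, p4⟩ := hf.ok h hg.vT hg.u4T
  set ψ := psiC u4 (x i) s t with hψ
  set C := setC u4 (x i) s t (x j) with hC
  have m0 : u4 ∈ C := by rw [hC, mem_setC]; simp
  have m1 : x i ∈ C := by rw [hC, mem_setC]; simp
  have m4 : x j ∈ C := by rw [hC, mem_setC]; simp
  have hn4 : ∀ m y, (cutT G T).Adj y u4 → u m ≠ y := by
    rintro m y hy rfl
    exact hg.n4 h m hy
  have hok1 := hok.ext h hg.vT (by omega) (x k) u4 1 (hf.xu4 k).2.1 m0 (hf.xu4 k).1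
    (by rw [p0]; decide) (by
      intro hm
      rw [hC, mem_setC] at hm
      rcases hm with hm | hm | hm | hm | hm
      · exact absurd hm (hf.xu4 k).ne
      · rw [hm, p1]
      · exact (notri h hg.vT (hf.xu4 i) (hm ▸ hf.xu4 k).symm hf.as).elim
      · exact (notri h hg.vT (hf.xu4 j) (hm ▸ hf.xu4 k).symm hf.tb.symm).elim
      · exact absurd hm hkj)
  have hujC : u j ∉ C := by
    intro hm
    rw [hC, mem_setC] at hm
    rcases hm with hm | hm | hm | hm | hm
    · exact hg.une j hm
    · exact hn4 j _ (hf.xu4 i) hm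
    · have := hf.xu j
      rw [hm] at this
      exact notri h hg.vT this hf.st hf.tb.symm
    · exact hut hm
    · exact hn4 j _ (hf.xu4 j) hm
  set ψ1 := Function.update ψ (x k) 1 with hψ1
  have r4 : ψ1 (x j) = 4 := by rw [hψ1, Function.update_of_ne hkj.symm, p4]
  have r1 : ψ1 (x i) = 1 := by
    by_cases hik : x i = x k
    · rw [hψ1, hik]; simp
    · rw [hψ1, Function.update_of_ne hik, p1]
  have r0 : ψ1 u4 = 0 := by rw [hψ1, Function.update_of_ne (hf.xu4 k).ne', p0]
  have rk : ψ1 (x k) = 1 := by simp [hψ1]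
  have hok2 := hok1.ext h hg.vT (by omega) (u j) (x j) 0 (hg.uT j) (Finset.mem_insert_of_mem m4)
    (hf.xu j).1.symm (by rw [r4]; decide) (by
      intro hm
      rcases Finset.mem_insert.1 hm with hm | hm
      · exact absurd hm (hn4 j _ (hf.xu4 k))
      · exact absurd hm hujC)
  set ψ2 := Function.update ψ1 (u j) 0 with hψ2
  have w1 : ψ2 (x i) = 1 := by rw [hψ2, Function.update_of_ne (hn4 j _ (hf.xu4 i)).symm, r1]
  have wk : ψ2 (x k) = 1 := by rw [hψ2, Function.update_of_ne (hn4 j _ (hf.xu4 k)).symm, rk]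
  have w0 : ψ2 u4 = 0 := by rw [hψ2, Function.update_of_ne (hg.une j).symm, r0]
  have wj : ψ2 (u j) = 0 := by simp [hψ2]
  have hm4 : u4 ∈ insert (u j) (insert (x k) C) := by simp [m0]
  obtain ⟨g, hgc, hcon⟩ := hok2.fin h hg.vT hg.T8 hg.v4 u4 (u j) hm4 (by simp) (hg.une j).symm
    (by rw [w0, wj])
  have c1 := hcon u4 hm4 (u j) (by simp) (by rw [w0, wj])
  have c2 := hcon (x i) (by simp [m1]) (x k) (by simp) (by rw [w1, wk])
  obtain ⟨b1, -⟩ := hg.bad g hgc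
  have d1 := hgc _ _ (hf.xu i)
  have d2 := hgc _ _ (hf.xu k)
  have d3 := hgc _ _ (hf.xu4 i)
  rw [← c2] at d2
  rw [c1] at d3
  exact CA_three _ _ _ _ d1 d2 d3 (b1 i k hf.ik) (b1 i j hf.ij) (b1 k j hf.jk.symm)

lemma core2a (h : SmallestCex G) {v : V} {T : Finset V} {u x : Fin 3 → V} {u4 s t : V}
    (hg : Gad G v T u u4) {i j k : Fin 3} (hf : Fin5 G T u x u4 s t i j k)
    (hki : x k = x i) (hut : u j = t) : False := by
  obtain ⟨hok, p0, p1, p2, p3, p4⟩ := hf.ok h hg.vT hg.u4T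
  set ψ := psiC u4 (x i) s t with hψ
  set C := setC u4 (x i) s t (x j) with hC
  have m1 : x i ∈ C := by rw [hC, mem_setC]; simp
  have hn4 : ∀ m y, (cutT G T).Adj y u4 → u m ≠ y := by
    rintro m y hy rfl
    exact hg.n4 h m hy
  have hmem : ∀ m, m ≠ j → u m ∈ C → ψ (u m) = 2 := by
    intro m hmj hm
    rw [hC, mem_setC] at hm
    rcases hm with hm | hm | hm | hm | hm
    · exact absurd hm (hg.une m)
    · exact absurd hm (hn4 m _ (hf.xu4 i))
    · rw [hm, p2]
    · exact absurd (hm.trans hut.symm) (hg.unn h m j hmj)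
    · exact absurd hm (hn4 m _ (hf.xu4 j))
  have hok1 := hok.ext h hg.vT (by omega) (u i) (x i) 2 (hg.uT i) m1 (hf.xu i).1.symm
    (by rw [p1]; decide) (hmem i hf.ij)
  have huik := hg.unn h i k hf.ik
  set ψ1 := Function.update ψ (u i) 2 with hψ1
  have r1 : ψ1 (x i) = 1 := by rw [hψ1, Function.update_of_ne (hf.xu i).ne, p1]
  have ri : ψ1 (u i) = 2 := by simp [hψ1]
  have hok2 := hok1.ext h hg.vT (by omega) (u k) (x i) 2 (hg.uT k) (Finset.mem_insert_of_mem m1)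
    (hki ▸ (hf.xu k).1.symm) (by rw [r1]; decide) (by
      intro hm
      rcases Finset.mem_insert.1 hm with hm | hm
      · exact absurd hm huik.symm
      · rw [hψ1, Function.update_of_ne huik.symm]
        exact hmem k hf.jk.symm hm)
  set ψ2 := Function.update ψ1 (u k) 2 with hψ2
  have wi : ψ2 (u i) = 2 := by rw [hψ2, Function.update_of_ne huik, ri]
  have wk : ψ2 (u k) = 2 := by simp [hψ2]
  obtain ⟨g, hgc, hcon⟩ := hok2.fin h hg.vT hg.T8 hg.v4 (u i) (u k) (by simp) (by simp) huik
    (by rw [wi, wk])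
  have c1 := hcon (u i) (by simp) (u k) (by simp) (by rw [wi, wk])
  exact (hg.bad g hgc).1 i k hf.ik c1

lemma core2b (h : SmallestCex G) {v : V} {T : Finset V} {u x : Fin 3 → V} {u4 s t : V}
    (hg : Gad G v T u u4) {i j k : Fin 3} (hf : Fin5 G T u x u4 s t i j k)
    (hkj : x k ≠ x j) (hus : u i = s) (hut : u j = t) : False := by
  obtain ⟨hok, p0, p1, p2, p3, p4⟩ := hf.ok h hg.vT hg.u4T
  set ψ := psiC u4 (x i) s t with hψ
  set C := setC u4 (x i) s t (x j) with hC
  have m0 : u4 ∈ C := by rw [hC, mem_setC]; simp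
  have m2 : u i ∈ C := by rw [hC, mem_setC, hus]; simp
  have hn4 : ∀ m y, (cutT G T).Adj y u4 → u m ≠ y := by
    rintro m y hy rfl
    exact hg.n4 h m hy
  have hok1 := hok.ext h hg.vT (by omega) (x k) u4 1 (hf.xu4 k).2.1 m0 (hf.xu4 k).1
    (by rw [p0]; decide) (by
      intro hm
      rw [hC, mem_setC] at hm
      rcases hm with hm | hm | hm | hm | hm
      · exact absurd hm (hf.xu4 k).ne
      · rw [hm, p1]
      · exact (notri h hg.vT (hf.xu4 i) (hm ▸ hf.xu4 k).symm hf.as).elim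
      · exact (notri h hg.vT (hf.xu4 j) (hm ▸ hf.xu4 k).symm hf.tb.symm).elim
      · exact absurd hm hkj)
  have huik := hg.unn h i k hf.ik
  have hujk := hg.unn h j k hf.jk
  have hukC : u k ∉ C := by
    intro hm
    rw [hC, mem_setC] at hm
    rcases hm with hm | hm | hm | hm | hm
    · exact hg.une k hm
    · exact hn4 k _ (hf.xu4 i) hm
    · exact huik (hus.trans hm.symm)
    · exact hujk (hut.trans hm.symm)
    · exact hn4 k _ (hf.xu4 j) hm
  set ψ1 := Function.update ψ (x k) 1 with hψ1
  have ri : ψ1 (u i) = 2 := by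
    rw [hψ1, Function.update_of_ne (hn4 i _ (hf.xu4 k)), hus, p2]
  have rk : ψ1 (x k) = 1 := by simp [hψ1]
  have hok2 := hok1.ext h hg.vT (by omega) (u k) (x k) 2 (hg.uT k) (by simp)
    (hf.xu k).1.symm (by rw [rk]; decide) (by
      intro hm
      rcases Finset.mem_insert.1 hm with hm | hm
      · exact absurd hm (hn4 k _ (hf.xu4 k))
      · exact absurd hm hukC)
  set ψ2 := Function.update ψ1 (u k) 2 with hψ2
  have wi : ψ2 (u i) = 2 := by rw [hψ2, Function.update_of_ne huik, ri]
  have wk : ψ2 (u k) = 2 := by simp [hψ2]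
  have hmi : u i ∈ insert (u k) (insert (x k) C) := by simp [m2]
  obtain ⟨g, hgc, hcon⟩ := hok2.fin h hg.vT hg.T8 hg.v4 (u i) (u k) hmi (by simp) huik
    (by rw [wi, wk])
  have c1 := hcon (u i) hmi (u k) (by simp) (by rw [wi, wk])
  exact (hg.bad g hgc).1 i k hf.ik c1

lemma coreall (h : SmallestCex G) {v : V} {T : Finset V} {u x : Fin 3 → V} {u4 s t : V}
    (hg : Gad G v T u u4) {i j k : Fin 3} (hf : Fin5 G T u x u4 s t i j k) : False := by
  by_cases hkj : x k = x j
  · have hki : x k ≠ x i := fun hh => hf.xij (hh.symm.trans hkj)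
    by_cases hus : u i = s
    · exact core2a h hg hf.swap hkj hus
    · exact core1 h hg hf.swap hki hus
  · by_cases hut : u j = t
    · by_cases hki : x k = x i
      · exact core2a h hg hf hki hut
      · by_cases hus : u i = s
        · exact core2b h hg hf hkj hus hut
        · exact core1 h hg hf.swap hki hus
    · exact core1 h hg hf hkj hut

/-- Extracting the 5-cycle from a triangle in the quotient. -/
lemma star_tri (h : SmallestCex G) {v : V} {T : Finset V} (hv : v ∈ T) {x : Fin 3 → V} {u4 : V}
    (hx4 : ∀ m, (cutT G T).Adj (x m) u4) (Z : Finset V)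
    (hZ : ∀ z, z ∈ Z ↔ z = u4 ∨ ∃ m, z = x m) (φ : V → Fin 5)
    (h4 : φ u4 = 0) (h1 : ∀ m, φ (x m) = 1) (p q r : V) (hp : p ∉ Z) 
    (hL : ∀ y z, ((y = p ∧ z = q) ∨ (y = p ∧ z = r) ∨ (y = q ∧ z = r) ∨ (y = q ∧ z = p)) →
      ∃ x' y', (cutT G T).Adj x' y' ∧ (x' = y ∨ (y ∈ Z ∧ x' ∈ Z ∧ φ x' = φ y)) ∧
              (y' = z ∨ (z ∈ Z ∧ y' ∈ Z ∧ φ y' = φ z))) :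
    ∃ i j s t, x i ≠ x j ∧ (cutT G T).Adj (x i) s ∧ (cutT G T).Adj s t ∧ (cutT G T).Adj t (x j) ∧
      s ≠ u4 ∧ t ≠ u4 := by
  have hu4Z : u4 ∈ Z := (hZ _).2 (Or.inl rfl)
  have hxZ : ∀ m, x m ∈ Z := fun m => (hZ _).2 (Or.inr ⟨m, rfl⟩)
  obtain ⟨p1, q1, e1, hp1, hq1⟩ := hL p q (Or.inl ⟨rfl, rfl⟩)
  obtain ⟨p2, r1, e2, hp2, hr1⟩ := hL p r (Or.inr (Or.inl ⟨rfl, rfl⟩))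
  obtain ⟨q2, r2, e3, hq2, hr2⟩ := hL q r (Or.inr (Or.inr (Or.inl ⟨rfl, rfl⟩)))
  have hp1 : p1 = p := by rcases hp1 with hh | hh; exacts [hh, absurd hh.1 hp]
  have hp2 : p2 = p := by rcases hp2 with hh | hh; exacts [hh, absurd hh.1 hp]
  subst hp1
  subst hp2
  -- class description
  have hcls : ∀ z z', z ∈ Z → (z' = z ∨ (z ∈ Z ∧ z' ∈ Z ∧ φ z' = φ z)) →
      (z' = u4 ∧ z = u4) ∨ ((∃ m, z' = x m) ∧ ∃ m, z = x m) := by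
    intro z z' hz hh
    rcases hh with rfl | ⟨_, h5, h6⟩
    · rcases (hZ z').1 hz with hh | hh
      · exact Or.inl ⟨hh, hh⟩
      · exact Or.inr ⟨hh, hh⟩
    · rcases (hZ z).1 hz with rfl | ⟨m, rfl⟩ <;> rcases (hZ z').1 h5 with rfl | ⟨m', rfl⟩
      · exact Or.inl ⟨rfl, rfl⟩
      · rw [h4, h1] at h6; exact absurd h6 (by decide)
      · rw [h4, h1] at h6; exact absurd h6 (by decide)
      · exact Or.inr ⟨⟨m', rfl⟩, ⟨m, rfl⟩⟩
  have hne4 : ∀ z, z ∉ Z → z ≠ u4 := fun z hz hh => hz (hh ▸ hu4Z)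
  by_cases hq : q ∈ Z
  · by_cases hr : r ∈ Z
    · exfalso
      rcases hcls q q1 hq hq1 with ⟨a1, a2⟩ | ⟨⟨m1, a1⟩, ⟨m2, a2⟩⟩ <;>
      rcases hcls r r1 hr hr1 with ⟨b1, b2⟩ | ⟨⟨m3, b1⟩, ⟨m4, b2⟩⟩
      · rcases hcls q q2 hq hq2 with ⟨c1, _⟩ | ⟨_, ⟨m5, c2⟩⟩
        · rcases hcls r r2 hr hr2 with ⟨d1, _⟩ | ⟨_, ⟨m6, d2⟩⟩
          · rw [c1, d1] at e3; exact e3.ne rfl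
          · exact (hx4 m6).ne (d2.symm.trans b2)
        · exact (hx4 m5).ne (c2.symm.trans a2)
      · rw [a1] at e1; rw [b1] at e2
        exact notri h hv e1 (hx4 m3).symm e2
      · rw [a1] at e1; rw [b1] at e2
        exact notri h hv e1 (hx4 m1) e2
      · rcases hcls q q2 hq hq2 with ⟨_, c2⟩ | ⟨⟨m5, c1⟩, _⟩
        · exact (hx4 m2).ne (a2.symm.trans c2)
        · rcases hcls r r2 hr hr2 with ⟨_, d2⟩ | ⟨⟨m6, d1⟩, _⟩
          · exact (hx4 m4).ne (b2.symm.trans d2)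
          · rw [c1, d1] at e3
            exact notri h hv e3 (hx4 m6) (hx4 m5)
    · have hr1 : r1 = r := by rcases hr1 with hh | hh; exacts [hh, absurd hh.1 hr]
      have hr2 : r2 = r := by rcases hr2 with hh | hh; exacts [hh, absurd hh.1 hr]
      subst hr1
      subst hr2
      rcases hcls q q1 hq hq1 with ⟨a1, a2⟩ | ⟨⟨m1, a1⟩, ⟨m2, a2⟩⟩ <;>
      rcases hcls q q2 hq hq2 with ⟨b1, b2⟩ | ⟨⟨m3, b1⟩, ⟨m4, b2⟩⟩
      · rw [a1] at e1; rw [b1] at e3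
        exact (notri h hv e1 e3 e2).elim
      · exact absurd (b2.symm.trans a2) (hx4 m4).ne
      · exact absurd (a2.symm.trans b2) (hx4 m2).ne
      · rw [a1] at e1; rw [b1] at e3
        refine ⟨m3, m1, r2, p2, ?_, e3, e2.symm, e1, hne4 _ hr, hne4 _ hp⟩
        intro he
        rw [he] at e3
        exact notri h hv e1 e3 e2
  · have hq1 : q1 = q := by rcases hq1 with hh | hh; exacts [hh, absurd hh.1 hq]
    have hq2 : q2 = q := by rcases hq2 with hh | hh; exacts [hh, absurd hh.1 hq]
    subst hq1
    subst hq2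
    by_cases hr : r ∈ Z
    · rcases hcls r r1 hr hr1 with ⟨a1, a2⟩ | ⟨⟨m1, a1⟩, ⟨m2, a2⟩⟩ <;>
      rcases hcls r r2 hr hr2 with ⟨b1, b2⟩ | ⟨⟨m3, b1⟩, ⟨m4, b2⟩⟩
      · rw [a1] at e2; rw [b1] at e3
        exact (notri h hv e1 e3 e2).elim
      · exact absurd (b2.symm.trans a2) (hx4 m4).ne
      · exact absurd (a2.symm.trans b2) (hx4 m2).ne
      · rw [a1] at e2; rw [b1] at e3
        refine ⟨m3, m1, q2, p2, ?_, e3.symm, e1.symm, e2, hne4 _ hq, hne4 _ hp⟩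
        intro he
        rw [he] at e3
        exact notri h hv e1 e3 e2
    · have hr1 : r1 = r := by rcases hr1 with hh | hh; exacts [hh, absurd hh.1 hr]
      have hr2 : r2 = r := by rcases hr2 with hh | hh; exacts [hh, absurd hh.1 hr]
      subst hr1
      subst hr2
      exact (notri h hv e1 e3 e2).elim

lemma PPP (h : SmallestCex G) {v : V} {T : Finset V} {u : Fin 3 → V} {u4 : V}
    (hg : Gad G v T u u4) : False := by
  choose x hxu hx4 using R2 h hg
  have hvT := hg.vT
  set Z : Finset V := insert u4 (Finset.univ.image x) with hZd
  have hZ : ∀ z, z ∈ Z ↔ z = u4 ∨ ∃ m, z = x m := by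
    intro z
    simp only [hZd, Finset.mem_insert, Finset.mem_image, Finset.mem_univ, true_and, eq_comm]
  have hout : ∀ z ∈ Z, z ∉ T := by
    intro z hz
    rcases (hZ z).1 hz with rfl | ⟨m, rfl⟩
    · exact hg.u4T
    · exact (hx4 m).2.1
  have hxx : ∀ m n, ¬ (cutT G T).Adj (x m) (x n) := fun m n hh => notri h hvT hh (hx4 n) (hx4 m)
  set φ : V → Fin 5 := fun z => if z = u4 then 0 else 1 with hφ
  have f4 : φ u4 = 0 := by simp [hφ]
  have fx : ∀ m, φ (x m) = 1 := fun m => by simp [hφ, (hx4 m).ne]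
  have hno : ∀ g, Col (cutT G T) g → (∀ x ∈ Z, ∀ y ∈ Z, φ x = φ y → g x = g y) → False := by
    intro g hgc hcon
    have hxe : ∀ m, g (x m) = g (x 0) := fun m => hcon _ ((hZ _).2 (Or.inr ⟨m, rfl⟩)) _
      ((hZ _).2 (Or.inr ⟨0, rfl⟩)) (by rw [fx, fx])
    have d : ∀ m, CA (g (x 0)) (g (u m)) := fun m => hxe m ▸ hgc _ _ (hxu m)
    obtain ⟨b1, -⟩ := hg.bad g hgc
    exact CA_three _ _ _ _ (d 0) (d 1) (d 2) (b1 0 1 (by decide)) (b1 0 2 (by decide))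
      (b1 1 2 (by decide))
  have hni : ∃ y ∈ Z, ∃ z ∈ Z, y ≠ z ∧ φ y = φ z := by
    by_contra hc
    push Not at hc
    obtain ⟨g0, hg0⟩ := cutT_col h hvT
    apply hno g0 hg0
    intro y hy z hz hyz
    by_contra hne
    exact hc y hy z hz (fun hh => hne (by rw [hh])) hyz
  obtain ⟨Q, hZQ, hQ, hcase⟩ := CL h (cutT G T) (cutT_le T) Z φ (by
    intro y hy z hz hyz
    rcases (hZ y).1 hy with rfl | ⟨m, rfl⟩ <;> rcases (hZ z).1 hz with rfl | ⟨n, rfl⟩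
    · exact absurd rfl hyz.ne
    · rw [f4, fx]; decide
    · rw [f4, fx]; decide
    · exact absurd hyz (hxx m n)) hni hno
  have houtQ : ∀ q ∈ Q, q ∉ T := by
    intro q hq
    rcases hQ q hq with h1 | ⟨w, hw⟩
    · exact hout q h1
    · exact hw.2.1
  have hu4Z : u4 ∈ Z := (hZ _).2 (Or.inl rfl)
  have hne : Q.Nonempty := ⟨u4, hZQ.subset hu4Z⟩
  have hT8 := hg.T8
  have hcd := card_disj houtQ
  have hvQ : v ∉ Q := fun hh => houtQ v hh hvT
  have hppZ : pp G Z ≤ 8 := by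
    have step : ∀ (A : Finset V) (m : Fin 3), u4 ∈ A → pp G (insert (x m) A) ≤ pp G A + 1 := by
      intro A m hA
      by_cases hm : x m ∈ A
      · rw [Finset.insert_eq_of_mem hm]; omega
      · exact pp_insert_le G A (x m) u4 hm hA (hx4 m).1
    have hZe : Z = insert (x 0) (insert (x 1) (insert (x 2) {u4})) := by
      ext z
      rw [hZ]
      simp only [Finset.mem_insert, Finset.mem_singleton]
      constructor
      · rintro (rfl | ⟨m, rfl⟩)
        · simp
        · fin_cases m <;> simp
      · rintro (hh | hh | hh | hh)
        · exact Or.inr ⟨0, hh⟩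
        · exact Or.inr ⟨1, hh⟩
        · exact Or.inr ⟨2, hh⟩
        · exact Or.inl hh
    rw [hZe]
    have s1 := step (insert (x 1) (insert (x 2) {u4})) 0 (by simp)
    have s2 := step (insert (x 2) {u4}) 1 (by simp)
    have s3 := step {u4} 2 (by simp)
    have s4 := pp_singleton G u4
    omega
  rw [pp_cutT houtQ, pp_cutT hout] at hcase
  rcases hcase with hc | ⟨hc, hc', -⟩ | ⟨-, -, a, b, c, hab, hac, hbc, hQe, hL⟩
  · have := L5 h Q hne (by omega)
    omega
  · have hZ1 : 1 ≤ Z.card := Finset.card_pos.2 ⟨u4, hu4Z⟩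
    rcases L6 h Q hne (by omega) v hvQ hg.v4 with h6 | h6 | h6 <;> omega
  · have hex : ∃ i j s t, x i ≠ x j ∧ (cutT G T).Adj (x i) s ∧ (cutT G T).Adj s t ∧
        (cutT G T).Adj t (x j) ∧ s ≠ u4 ∧ t ≠ u4 := by
      have hsome : a ∉ Z ∨ b ∉ Z ∨ c ∉ Z := by
        by_contra hcc
        push Not at hcc
        apply hZQ.ne
        rw [hQe]
        symm
        rw [Finset.union_eq_left]
        intro z hz
        simp only [Finset.mem_insert, Finset.mem_singleton] at hz
        rcases hz with rfl | rfl | rfl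
        · exact hcc.1
        · exact hcc.2.1
        · exact hcc.2.2
      rcases hsome with ha | hb | hc
      · apply star_tri h hvT hx4 Z hZ φ f4 fx a b c ha
        intro y z hyz
        apply hL
        · rcases hyz with ⟨rfl, rfl⟩ | ⟨rfl, rfl⟩ | ⟨rfl, rfl⟩ | ⟨rfl, rfl⟩ <;> simp
        · rcases hyz with ⟨rfl, rfl⟩ | ⟨rfl, rfl⟩ | ⟨rfl, rfl⟩ | ⟨rfl, rfl⟩ <;> simp
        · rcases hyz with ⟨rfl, rfl⟩ | ⟨rfl, rfl⟩ | ⟨rfl, rfl⟩ | ⟨rfl, rfl⟩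
          exacts [hab, hac, hbc, hab.symm]
      · apply star_tri h hvT hx4 Z hZ φ f4 fx b a c hb
        intro y z hyz
        apply hL
        · rcases hyz with ⟨rfl, rfl⟩ | ⟨rfl, rfl⟩ | ⟨rfl, rfl⟩ | ⟨rfl, rfl⟩ <;> simp
        · rcases hyz with ⟨rfl, rfl⟩ | ⟨rfl, rfl⟩ | ⟨rfl, rfl⟩ | ⟨rfl, rfl⟩ <;> simp
        · rcases hyz with ⟨rfl, rfl⟩ | ⟨rfl, rfl⟩ | ⟨rfl, rfl⟩ | ⟨rfl, rfl⟩
          exacts [hab.symm, hbc, hac, hab]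
      · apply star_tri h hvT hx4 Z hZ φ f4 fx c a b hc
        intro y z hyz
        apply hL
        · rcases hyz with ⟨rfl, rfl⟩ | ⟨rfl, rfl⟩ | ⟨rfl, rfl⟩ | ⟨rfl, rfl⟩ <;> simp
        · rcases hyz with ⟨rfl, rfl⟩ | ⟨rfl, rfl⟩ | ⟨rfl, rfl⟩ | ⟨rfl, rfl⟩ <;> simp
        · rcases hyz with ⟨rfl, rfl⟩ | ⟨rfl, rfl⟩ | ⟨rfl, rfl⟩ | ⟨rfl, rfl⟩
          exacts [hac.symm, hbc.symm, hab, hac]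
    obtain ⟨i, j, s, t, hxij, h1, h2, h3, h4, h5⟩ := hex
    have hij : i ≠ j := by rintro rfl; exact hxij rfl
    have hth : ∀ i j : Fin 3, i ≠ j → ∃ k, i ≠ k ∧ j ≠ k := by decide
    obtain ⟨k, hik, hjk⟩ := hth i j hij
    exact coreall h hg (i := i) (j := j) (k := k)
      ⟨hxu, hx4, hxij, hij, hik, hjk, h1, h2, h3, h4, h5⟩

end Psec


lemma CA_walk4 : ∀ x y : Fin 5, ∃ a b c, CA x a ∧ CA a b ∧ CA b c ∧ CA c y := by decide
lemma CA_walk3 : ∀ x y : Fin 5, x ≠ y → ∃ a b, CA x a ∧ CA a b ∧ CA b y := by decide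
lemma CA_walk2 : ∀ x y : Fin 5, ¬ CA x y → ∃ a, CA x a ∧ CA a y := by decide
lemma CA_choose : ∀ p q r s : Fin 5, (∀ c, c ≠ p → c ≠ q → c ≠ r → CA c s) →
    p ≠ q ∧ p ≠ r ∧ q ≠ r ∧ ¬ CA p s ∧ ¬ CA q s ∧ ¬ CA r s := by decide

section Gsec
open Classical

variable {V : Type} [Fintype V] {G : SimpleGraph V}

lemma ext_col {T : Finset V} {g g' : V → Fin 5} (hg : Col (cutT G T) g)
    (hoff : ∀ y, y ∉ T → g' y = g y) (hT : ∀ x ∈ T, ∀ y, G.Adj x y → CA (g' x) (g' y)) :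
    Col G g' := by
  intro x y hxy
  by_cases hx : x ∈ T
  · exact hT x hx y hxy
  by_cases hy : y ∈ T
  · exact CA_symm (hT y hy x hxy.symm)
  rw [hoff x hx, hoff y hy]
  exact hg x y ⟨hxy, hx, hy⟩

lemma nbr2 {w p q : V} (hd : deg G w = 2) (hp : G.Adj w p) (hq : G.Adj w q) (hpq : p ≠ q) :
    ∀ y, G.Adj w y ↔ y = p ∨ y = q := by
  have : ({p, q} : Set V) = G.neighborSet w := by
    apply Set.eq_of_subset_of_ncard_le
    · rintro y (rfl | rfl)
      · exact hp
      · exact hq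
    · rw [Set.ncard_pair hpq]; exact hd.le
    · exact Set.toFinite _
  intro y
  rw [← SimpleGraph.mem_neighborSet, ← this]
  simp

lemma str_int {v u : V} {p : G.Walk v u} (hs : IsString G p) (k : ℕ) (hk : k + 2 ≤ p.length) :
    deg G (p.getVert (k + 1)) = 2 ∧
    (∀ y, G.Adj (p.getVert (k + 1)) y ↔ y = p.getVert k ∨ y = p.getVert (k + 2)) := by
  have hinj := hs.1.getVert_injOn
  have hd : deg G (p.getVert (k + 1)) = 2 := by
    apply hs.2.2.2.2 _ (p.getVert_mem_support _)
    · intro he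
      have he := he.trans p.getVert_zero.symm
      have := hinj (by simp; omega) (by simp) he
      omega
    · intro he
      have he := he.trans p.getVert_length.symm
      have := hinj (by simp; omega) (by simp) he
      omega
  refine ⟨hd, nbr2 hd ?_ ?_ ?_⟩
  · exact (p.adj_getVert_succ (by omega)).symm
  · exact p.adj_getVert_succ (by omega)
  · intro he
    have := hinj (by simp; omega) (by simp; omega) he
    omega

lemma str_ne {v u : V} {p : G.Walk v u} (hs : IsString G p) (j k : ℕ) (hj : j ≤ p.length)
    (hk : k ≤ p.length) (hjk : j ≠ k) : p.getVert j ≠ p.getVert k :=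
  fun he => hjk (hs.1.getVert_injOn hj hk he)

lemma str_le3 (h : SmallestCex G) {v u : V} {p : G.Walk v u} (hs : IsString G p) :
    p.length ≤ 3 := by
  by_contra hc
  push Not at hc
  have n1 := (str_int hs 0 (by omega)).2
  have n2 := (str_int hs 1 (by omega)).2
  have n3 := (str_int hs 2 (by omega)).2
  have d := fun j k hj hk => str_ne hs j k hj hk
  have d01 := d 0 1 (by omega) (by omega) (by omega)
  have d02 := d 0 2 (by omega) (by omega) (by omega)
  have d03 := d 0 3 (by omega) (by omega) (by omega)
  have d12 := d 1 2 (by omega) (by omega) (by omega)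
  have d13 := d 1 3 (by omega) (by omega) (by omega)
  have d14 := d 1 4 (by omega) (by omega) (by omega)
  have d23 := d 2 3 (by omega) (by omega) (by omega)
  have d24 := d 2 4 (by omega) (by omega) (by omega)
  have d34 := d 3 4 (by omega) (by omega) (by omega)
  clear d
  norm_num only [] at n1 n2 n3
  generalize p.getVert 0 = w0 at *
  generalize p.getVert 1 = w1 at *
  generalize p.getVert 2 = w2 at *
  generalize p.getVert 3 = w3 at *
  generalize p.getVert 4 = w4 at *
  obtain ⟨g, hg⟩ := cutT_col h (T := {w1, w2, w3}) (v := w1) (by simp)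
  obtain ⟨a, b, c, h1, h2, h3, h4⟩ := CA_walk4 (g w0) (g w4)
  set g' : V → Fin 5 := fun y => if y = w1 then a else if y = w2 then b else if y = w3 then c else g y
    with hg'
  have e1 : g' w1 = a := by simp [hg']
  have e2 : g' w2 = b := by simp [hg', d12.symm]
  have e3 : g' w3 = c := by simp [hg', d13.symm, d23.symm]
  have e0 : g' w0 = g w0 := by simp [hg', d01, d02, d03]
  have e4 : g' w4 = g w4 := by simp [hg', d14.symm, d24.symm, d34.symm]
  apply not_col_of_isEmpty h.1.1 g'
  apply ext_col hg
  · intro y hy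
    simp only [Finset.mem_insert, Finset.mem_singleton, not_or] at hy
    simp [hg', hy]
  · intro x hx y hxy
    simp only [Finset.mem_insert, Finset.mem_singleton] at hx
    rcases hx with rfl | rfl | rfl
    · rcases (n1 y).1 hxy with rfl | rfl
      · rw [e1, e0]; exact CA_symm h1
      · rw [e1, e2]; exact h2
    · rcases (n2 y).1 hxy with rfl | rfl
      · rw [e2, e1]; exact CA_symm h2
      · rw [e2, e3]; exact h3
    · rcases (n3 y).1 hxy with rfl | rfl
      · rw [e3, e2]; exact CA_symm h3
      · rw [e3, e4]; exact h4

/-- The leg of a string of length three. -/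
structure Leg (G : SimpleGraph V) (v u a b : V) : Prop where
  da : deg G a = 2
  db : deg G b = 2
  Na : ∀ y, G.Adj a y ↔ y = v ∨ y = b
  Nb : ∀ y, G.Adj b y ↔ y = a ∨ y = u
  vb : b ≠ v
  uv : u ≠ v

lemma leg3 {v u : V} {p : G.Walk v u} (hs : IsString G p) (hl : p.length = 3) :
    Leg G v u (p.getVert 1) (p.getVert 2) := by
  have n1 := str_int hs 0 (by omega)
  have n2 := str_int hs 1 (by omega)
  have e3 : p.getVert 3 = u := by rw [← hl, p.getVert_length]
  norm_num only [p.getVert_zero, e3] at n1 n2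
  have d1 := str_ne hs 2 0 (by omega) (by omega) (by omega)
  have d2 := str_ne hs 3 0 (by omega) (by omega) (by omega)
  rw [p.getVert_zero] at d1 d2
  rw [e3] at d2
  exact ⟨n1.1, n2.1, n1.2, n2.2, d1, d2⟩

lemma gad_contra (h : SmallestCex G) {v : V} (hdeg : deg G v = 4) {a b u : Fin 3 → V} {d u4 : V}
    (hleg : ∀ i, Leg G v (u i) (a i) (b i)) (hu3 : ∀ i, 3 ≤ deg G (u i))
    (hdd : deg G d = 2) (hNd : ∀ y, G.Adj d y ↔ y = v ∨ y = u4)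
    (ha : Function.Injective a) (had : ∀ i, a i ≠ d)
    (h4v : u4 ≠ v) (h4d : u4 ≠ d) (h4a : ∀ i, u4 ≠ a i) (h4b : ∀ i, u4 ≠ b i)
    (h4u : ∀ i, u i ≠ u4) : False := by
  have hva : ∀ i, v ≠ a i := fun i => ((hleg i).Na v |>.2 (Or.inl rfl)).ne'
  have hvd : v ≠ d := ((hNd v).2 (Or.inl rfl)).ne'
  have hab : ∀ i j, a i ≠ b j := by
    intro i j he
    have h1 := ((hleg i).Na v).2 (Or.inl rfl)
    rw [he] at h1
    rcases ((hleg j).Nb v).1 h1 with hh | hh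
    · exact hva j hh
    · exact (hleg j).uv hh.symm
  have hdb : ∀ j, d ≠ b j := by
    intro j he
    have h1 := (hNd v).2 (Or.inl rfl)
    rw [he] at h1
    rcases ((hleg j).Nb v).1 h1 with hh | hh
    · exact hva j hh
    · exact (hleg j).uv hh.symm
  have hua : ∀ i j, u i ≠ a j := by
    intro i j he
    have := hu3 i
    rw [he, (hleg j).da] at this
    omega
  have hub : ∀ i j, u i ≠ b j := by
    intro i j he
    have := hu3 i
    rw [he, (hleg j).db] at this
    omega
  have hud : ∀ i, u i ≠ d := by
    intro i he
    have := hu3 i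
    rw [he, hdd] at this
    omega
  have huv : ∀ i, u i ≠ v := fun i => (hleg i).uv
  have hbv : ∀ i, b i ≠ v := fun i => (hleg i).vb
  have hb : Function.Injective b := by
    intro i j he
    by_contra hne
    have h1 := ((hleg i).Nb (a i)).2 (Or.inl rfl)
    rw [he] at h1
    rcases ((hleg j).Nb _).1 h1 with hh | hh
    · exact hne (ha hh)
    · exact hua j i hh.symm
  -- neighbours of v
  have hnbv : Finset.card (insert d (Finset.univ.image a)) = 4 := by
    rw [Finset.card_insert_of_notMem, Finset.card_image_of_injective _ ha]
    · simp
    · simp only [Finset.mem_image, Finset.mem_univ, true_and, not_exists]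
      exact fun i => had i
  have hsubv : ((insert d (Finset.univ.image a) : Finset V) : Set V) = G.neighborSet v := by
    apply Set.eq_of_subset_of_ncard_le
    · intro y hy
      simp only [Finset.coe_insert, Finset.coe_image, Finset.coe_univ, Set.image_univ,
        Set.mem_insert_iff, Set.mem_range] at hy
      rw [SimpleGraph.mem_neighborSet]
      rcases hy with rfl | ⟨i, rfl⟩
      · exact ((hNd v).2 (Or.inl rfl)).symm
      · exact (((hleg i).Na v).2 (Or.inl rfl)).symm
    · rw [Set.ncard_coe_finset, hnbv]; exact hdeg.le
    · exact Set.toFinite _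
  have hNv : ∀ y, G.Adj v y → y = d ∨ ∃ i, y = a i := by
    intro y hy
    rw [← SimpleGraph.mem_neighborSet, ← hsubv] at hy
    simp only [Finset.coe_insert, Finset.coe_image, Finset.coe_univ, Set.image_univ,
        Set.mem_insert_iff, Set.mem_range] at hy
    rcases hy with rfl | ⟨i, rfl⟩
    · simp
    · exact Or.inr ⟨i, rfl⟩
  set T : Finset V := insert v (insert d (Finset.univ.image a ∪ Finset.univ.image b)) with hT
  have mT : ∀ y, y ∈ T ↔ y = v ∨ y = d ∨ (∃ i, y = a i) ∨ ∃ i, y = b i := by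
    intro y
    simp only [hT, Finset.mem_insert, Finset.mem_union, Finset.mem_image, Finset.mem_univ, true_and,
      eq_comm]
  have hT8 : T.card = 8 := by
    have hdis : Disjoint (Finset.univ.image a) (Finset.univ.image b) := by
      rw [Finset.disjoint_left]
      intro y hy hy'
      obtain ⟨i, -, rfl⟩ := Finset.mem_image.1 hy
      obtain ⟨j, -, hj⟩ := Finset.mem_image.1 hy'
      exact hab i j hj.symm
    rw [hT, Finset.card_insert_of_notMem, Finset.card_insert_of_notMem,
      Finset.card_union_of_disjoint hdis, Finset.card_image_of_injective _ ha,
      Finset.card_image_of_injective _ hb]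
    · simp
    · simp only [Finset.mem_union, Finset.mem_image, Finset.mem_univ, true_and, not_or, not_exists]
      exact ⟨fun i => had i, fun i => (hdb i).symm⟩
    · simp only [Finset.mem_insert, Finset.mem_union, Finset.mem_image, Finset.mem_univ, true_and,
        not_or, not_exists]
      exact ⟨hvd, fun i => (hva i).symm, fun i => hbv i⟩
  have vT : v ∈ T := (mT v).2 (Or.inl rfl)
  have uT : ∀ i, u i ∉ T := by
    intro i hi
    rcases (mT _).1 hi with hh | hh | ⟨j, hh⟩ | ⟨j, hh⟩
    · exact huv i hh
    · exact hud i hh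
    · exact hua i j hh
    · exact hub i j hh
  have u4T : u4 ∉ T := by
    intro hi
    rcases (mT _).1 hi with hh | hh | ⟨j, hh⟩ | ⟨j, hh⟩
    · exact h4v hh
    · exact h4d hh
    · exact h4a j hh
    · exact h4b j hh
  apply PPP h (v := v) (T := T) (u := u) (u4 := u4)
  refine ⟨vT, ?_, hT8.ge, uT, u4T, h4u, ?_, ?_, ?_⟩
  · have : nb G v Finset.univ = insert d (Finset.univ.image a) := by
      apply Finset.coe_injective
      rw [hsubv]
      ext y
      simp [nb]
    rw [this, hnbv]
  · intro i
    exact ⟨b i, (mT _).2 (Or.inr (Or.inr (Or.inr ⟨i, rfl⟩))),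
      (((hleg i).Nb _).2 (Or.inr rfl)).symm⟩
  · exact ⟨d, (mT _).2 (Or.inr (Or.inl rfl)), ((hNd _).2 (Or.inr rfl)).symm⟩
  · intro g hg
    have hall : ∀ c, c ≠ g (u 0) → c ≠ g (u 1) → c ≠ g (u 2) → CA c (g u4) := by
      intro c h0 h1 h2
      by_contra hc
      have hcu : ∀ i, c ≠ g (u i) := by
        intro i
        fin_cases i
        exacts [h0, h1, h2]
      obtain ⟨δ, hδ1, hδ2⟩ := CA_walk2 c (g u4) hc
      choose α β hα1 hα2 hα3 using fun i => CA_walk3 c (g (u i)) (hcu i)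
      let g' : V → Fin 5 := fun y =>
        if y = v then c else if y = d then δ else
          if h1 : ∃ i, y = a i then α h1.choose else if h2 : ∃ i, y = b i then β h2.choose else g y
      have gv : g' v = c := by simp [g']
      have gd : g' d = δ := by simp [g', hvd.symm]
      have ga : ∀ i, g' (a i) = α i := by
        intro i
        have hex : ∃ j, a i = a j := ⟨i, rfl⟩
        have : hex.choose = i := (ha hex.choose_spec).symm
        simp only [g', (hva i).symm, had i, if_false, hex, dite_true, this]
      have gb : ∀ i, g' (b i) = β i := by
        intro i
        have hno : ¬ ∃ j, b i = a j := by rintro ⟨j, hj⟩; exact hab j i hj.symm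
        have hex : ∃ j, b i = b j := ⟨i, rfl⟩
        have : hex.choose = i := (hb hex.choose_spec).symm
        simp only [g', hbv i, (hdb i).symm, if_false, hno, dite_false, hex, dite_true, this]
      have goff : ∀ y, y ∉ T → g' y = g y := by
        intro y hy
        rw [mT] at hy
        push Not at hy
        have n1 : ¬ ∃ i, y = a i := by rintro ⟨i, hi⟩; exact hy.2.2.1 i hi
        have n2 : ¬ ∃ i, y = b i := by rintro ⟨i, hi⟩; exact hy.2.2.2 i hi
        simp only [g', hy.1, hy.2.1, if_false, n1, n2, dite_false]
      apply not_col_of_isEmpty h.1.1 g'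
      apply ext_col hg goff
      intro x hx y hxy
      rcases (mT x).1 hx with rfl | rfl | ⟨i, rfl⟩ | ⟨i, rfl⟩
      · rcases hNv y hxy with rfl | ⟨i, rfl⟩
        · rw [gv, gd]; exact hδ1
        · rw [gv, ga]; exact hα1 i
      · rcases (hNd y).1 hxy with rfl | rfl
        · rw [gv, gd]; exact CA_symm hδ1
        · rw [gd, goff _ u4T]; exact hδ2
      · rcases ((hleg i).Na y).1 hxy with rfl | rfl
        · rw [gv, ga]; exact CA_symm (hα1 i)
        · rw [ga, gb]; exact hα2 i
      · rcases ((hleg i).Nb y).1 hxy with rfl | rfl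
        · rw [gb, ga]; exact CA_symm (hα2 i)
        · rw [gb, goff _ (uT i)]; exact hα3 i
    obtain ⟨b1, b2, b3, b4, b5, b6⟩ := CA_choose _ _ _ _ hall
    constructor
    · intro i j hij
      fin_cases i <;> fin_cases j <;>
        first
        | exact absurd rfl hij
        | exact b1
        | exact b2
        | exact b3
        | exact b1.symm
        | exact b2.symm
        | exact b3.symm
    · intro i
      fin_cases i
      exacts [b4, b5, b6]

lemma five {v a b u d : V} (h1 : G.Adj v a) (h2 : G.Adj a b) (h3 : G.Adj b u) (h4 : G.Adj u d)
    (h5 : G.Adj d v) (e1 : a ≠ u) (e2 : a ≠ d) (e3 : b ≠ d) (e4 : b ≠ v) (e5 : u ≠ v) :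
    InFiveCycle G v := by
  refine ⟨v, Walk.cons h1 (Walk.cons h2 (Walk.cons h3 (Walk.cons h4 (Walk.cons h5 Walk.nil)))), ?_,
    by simp, by simp⟩
  rw [Walk.cons_isCycle_iff]
  have n1 := h1.ne
  have n2 := h2.ne
  have n3 := h3.ne
  have n4 := h4.ne
  have n5 := h5.ne
  constructor
  · simp [Walk.cons_isPath_iff, *, n1.symm]
  · simp [*, n1.symm, e4.symm, e5.symm, n5.symm, n1]

lemma weight_seven_false (h : SmallestCex G) (v : V) (hdeg : deg G v = 4) (hnc : ¬ InFiveCycle G v)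
    (u1 u2 u3 u4 : V) (p1 : G.Walk v u1) (p2 : G.Walk v u2)
    (p3 : G.Walk v u3) (p4 : G.Walk v u4)
    (hs1 : IsString G p1) (hs2 : IsString G p2) (hs3 : IsString G p3) (hs4 : IsString G p4)
    (h12 : p1.getVert 1 ≠ p2.getVert 1) (h13 : p1.getVert 1 ≠ p3.getVert 1)
    (h14 : p1.getVert 1 ≠ p4.getVert 1) (h23 : p2.getVert 1 ≠ p3.getVert 1)
    (h24 : p2.getVert 1 ≠ p4.getVert 1) (h34 : p3.getVert 1 ≠ p4.getVert 1)
    (l1 : p1.length = 3) (l2 : p2.length = 3) (l3 : p3.length = 3)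
    (l4 : p4.length = 2 ∨ p4.length = 3) : False := by
  let a : Fin 3 → V := ![p1.getVert 1, p2.getVert 1, p3.getVert 1]
  let b : Fin 3 → V := ![p1.getVert 2, p2.getVert 2, p3.getVert 2]
  let u : Fin 3 → V := ![u1, u2, u3]
  have hleg : ∀ i, Leg G v (u i) (a i) (b i) := by
    intro i
    fin_cases i
    exacts [leg3 hs1 l1, leg3 hs2 l2, leg3 hs3 l3]
  have hu3 : ∀ i, 3 ≤ deg G (u i) := by
    intro i
    fin_cases i
    exacts [hs1.2.2.2.1, hs2.2.2.2.1, hs3.2.2.2.1]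
  have ha : Function.Injective a := by
    intro i j hij
    by_contra hne
    fin_cases i <;> fin_cases j <;>
      first
      | exact hne rfl
      | exact h12 hij
      | exact h13 hij
      | exact h23 hij
      | exact h12 hij.symm
      | exact h13 hij.symm
      | exact h23 hij.symm
  have had : ∀ i, a i ≠ p4.getVert 1 := by
    intro i
    fin_cases i
    exacts [h14, h24, h34]
  have hva : ∀ i, v ≠ a i := fun i => ((hleg i).Na v |>.2 (Or.inl rfl)).ne'
  have hdv0 : G.Adj (p4.getVert 1) v := by
    have := p4.adj_getVert_succ (i := 0) (by omega)
    rw [p4.getVert_zero] at this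
    exact this.symm
  have hdb : ∀ j, p4.getVert 1 ≠ b j := by
    intro j he
    rw [he] at hdv0
    rcases ((hleg j).Nb v).1 hdv0 with hh | hh
    · exact hva j hh
    · exact (hleg j).uv hh.symm
  rcases l4 with l4 | l4
  · have n1 := str_int hs4 0 (by omega)
    have e2 : p4.getVert 2 = u4 := by rw [← l4, p4.getVert_length]
    norm_num only [p4.getVert_zero, e2] at n1
    have hd4 := hs4.2.2.2.1
    have h4v : u4 ≠ v := by
      have := str_ne hs4 2 0 (by omega) (by omega) (by omega)
      rwa [p4.getVert_zero, e2] at this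
    refine gad_contra h hdeg hleg hu3 n1.1 n1.2 ha had h4v ?_ ?_ ?_ ?_
    · intro he; rw [he, n1.1] at hd4; omega
    · intro i he; rw [he, (hleg i).da] at hd4; omega
    · intro i he; rw [he, (hleg i).db] at hd4; omega
    · intro i he
      apply hnc
      have A1 := ((hleg i).Na v).2 (Or.inl rfl)
      have A2 := ((hleg i).Na (b i)).2 (Or.inr rfl)
      have A3 := ((hleg i).Nb (u i)).2 (Or.inr rfl)
      have A4 : G.Adj (p4.getVert 1) (u i) := (n1.2 _).2 (Or.inr he)
      refine five A1.symm A2 A3 A4.symm hdv0 ?_ (had i) (hdb i).symm (hleg i).vb (hleg i).uv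
      intro hh
      have := hu3 i
      rw [← hh, (hleg i).da] at this
      omega
  · have L := leg3 hs4 l4
    refine gad_contra h hdeg hleg hu3 L.da L.Na ha had L.vb ?_ ?_ ?_ ?_
    · exact ((L.Na _).2 (Or.inr rfl)).ne'
    · intro i he
      have A1 := ((hleg i).Na v).2 (Or.inl rfl)
      rw [← he] at A1
      rcases (L.Nb v).1 A1 with hh | hh
      · exact hdv0.ne hh.symm
      · exact L.uv hh.symm
    · intro i he
      have A1 := (L.Nb _).2 (Or.inl rfl)
      rw [he] at A1
      rcases ((hleg i).Nb _).1 A1 with hh | hh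
      · exact had i hh.symm
      · have := hu3 i
        rw [← hh, L.da] at this
        omega
    · intro i he
      have := hu3 i
      rw [he, L.db] at this
      omega

end Gsec

/-- In a smallest counterexample, every vertex of degree four not
contained in any 5-cycle has weight at most 6. (The vertex being a `(k₁,k₂,k₃,k₄)`-vertex
is expressed by the four strings leaving `v` through its four distinct edges; its weight
is the sum of the `kᵢ = pᵢ.length - 1`.) -/
theorem smallestCex_degree_four_weight {V : Type} [Fintype V] (G : SimpleGraph V)
    (h : SmallestCex G) (v : V) (hdeg : deg G v = 4) (hnc : ¬ InFiveCycle G v)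
    (u1 u2 u3 u4 : V) (p1 : G.Walk v u1) (p2 : G.Walk v u2)
    (p3 : G.Walk v u3) (p4 : G.Walk v u4)
    (hs1 : IsString G p1) (hs2 : IsString G p2) (hs3 : IsString G p3) (hs4 : IsString G p4)
    (h12 : p1.getVert 1 ≠ p2.getVert 1) (h13 : p1.getVert 1 ≠ p3.getVert 1)
    (h14 : p1.getVert 1 ≠ p4.getVert 1) (h23 : p2.getVert 1 ≠ p3.getVert 1)
    (h24 : p2.getVert 1 ≠ p4.getVert 1) (h34 : p3.getVert 1 ≠ p4.getVert 1) :
    (p1.length - 1) + (p2.length - 1) + (p3.length - 1) + (p4.length - 1) ≤ 6 := by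
  by_contra hc
  have q1 := str_le3 h hs1
  have q2 := str_le3 h hs2
  have q3 := str_le3 h hs3
  have q4 := str_le3 h hs4
  by_cases c4 : p1.length = 3 ∧ p2.length = 3 ∧ p3.length = 3
  · exact weight_seven_false h v hdeg hnc u1 u2 u3 u4 p1 p2 p3 p4 hs1 hs2 hs3 hs4 h12 h13 h14 h23 h24 h34
      c4.1 c4.2.1 c4.2.2 (by omega)
  by_cases c3 : p1.length = 3 ∧ p2.length = 3 ∧ p4.length = 3
  · exact weight_seven_false h v hdeg hnc u1 u2 u4 u3 p1 p2 p4 p3 hs1 hs2 hs4 hs3 h12 h14 h13 h24 h23 h34.symm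
      c3.1 c3.2.1 c3.2.2 (by omega)
  by_cases c2 : p1.length = 3 ∧ p3.length = 3 ∧ p4.length = 3
  · exact weight_seven_false h v hdeg hnc u1 u3 u4 u2 p1 p3 p4 p2 hs1 hs3 hs4 hs2 h13 h14 h12 h34 h23.symm h24.symm
      c2.1 c2.2.1 c2.2.2 (by omega)
  · exact weight_seven_false h v hdeg hnc u2 u3 u4 u1 p2 p3 p4 p1 hs2 hs3 hs4 hs1 h23 h24 h12.symm h34 h13.symm
      h14.symm (by omega) (by omega) (by omega) (by omega)
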